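/- Let q be a prime power and S a surface of degree d in P^3 over F_q without F_q-plane components, with 2 ≤ d ≤ q+1 and N_q(S) = (d-1)q^2 + dq + 1. Then d = 2, or q is a square and d = √q + 1, or d = q + 1. -/

import Mathlib

open MvPolynomial

variable {K : Type} [Field K]

/-- The linear form `∑ aᵢ Xᵢ` as a multivariate polynomial. -/
noncomputable def linForm {n : ℕ} (a : Fin n → K) : MvPolynomial (Fin n) K :=
  ∑ i, C (a i) * X i

/-- The linear form `v ↦ ∑ aᵢ vᵢ` as a linear map. -/
noncomputable def linMap {n : ℕ} (a : Fin n → K) : (Fin n → K) →ₗ[K] K :=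
  ∑ i, a i • LinearMap.proj i

/-- Substitution `F(M·X)` of a linear change of variables into `F`. -/
noncomputable def substLin {n : ℕ} (M : Matrix (Fin n) (Fin n) K)
    (F : MvPolynomial (Fin n) K) : MvPolynomial (Fin n) K :=
  MvPolynomial.aeval (fun i => ∑ j, C (M i j) * X j) F

/-- Projective equivalence over `K` of two forms. -/
def ProjEquiv {n : ℕ} (F G : MvPolynomial (Fin n) K) : Prop :=
  ∃ M : Matrix (Fin n) (Fin n) K, IsUnit M.det ∧
    ∃ c : K, c ≠ 0 ∧ substLin M F = C c * G

/-- An `F_q`-line in `P^3` (resp. `P^2`), as a 2-dimensional linear subspace. -/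
def IsLine {n : ℕ} (W : Submodule K (Fin n → K)) : Prop := Module.finrank K W = 2

/-- An `F_q`-plane in `P^3`, as a 3-dimensional linear subspace. -/
def IsPlane (W : Submodule K (Fin 4 → K)) : Prop := Module.finrank K W = 3

/-- The section `S ∩ H` of the surface `S = {F = 0}` with the plane `H` given by the
subspace `W` is a planar `F_q`-pencil of degree `d` with vertex `P`: modulo the linear
form defining `H`, `F` is a nonzero scalar times a product of `d` linear forms over `F_q`
cutting out `d` pairwise distinct lines of `H`, all passing through the point `P`. -/
def IsPencil (F : MvPolynomial (Fin 4) K) (d : ℕ)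
    (W : Submodule K (Fin 4 → K)) (P : Projectivization K (Fin 4 → K)) : Prop :=
  ∃ (a : Fin 4 → K) (m : Fin d → Fin 4 → K) (c : K) (g : MvPolynomial (Fin 4) K),
    a ≠ 0 ∧ W = LinearMap.ker (linMap a) ∧ c ≠ 0 ∧
    F = C c * (∏ i, linForm (m i)) + linForm a * g ∧
    (∀ i, IsLine (LinearMap.ker (linMap a) ⊓ LinearMap.ker (linMap (m i)))) ∧
    (∀ i j, i ≠ j →
      LinearMap.ker (linMap a) ⊓ LinearMap.ker (linMap (m i)) ≠
      LinearMap.ker (linMap a) ⊓ LinearMap.ker (linMap (m j))) ∧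
    P.rep ∈ W ∧ (∀ i, linMap (m i) P.rep = 0)

/-- The restriction of `F` to the plane `H` given by the subspace `W` has a linear
factor over `F_q` (i.e. the section `S ∩ H` has an `F_q`-line component). -/
def SectionHasLineComp (F : MvPolynomial (Fin 4) K)
    (W : Submodule K (Fin 4 → K)) : Prop :=
  ∃ (a b : Fin 4 → K) (h g : MvPolynomial (Fin 4) K),
    a ≠ 0 ∧ W = LinearMap.ker (linMap a) ∧
    IsLine (LinearMap.ker (linMap a) ⊓ LinearMap.ker (linMap b)) ∧
    F = linForm b * h + linForm a * g

/-- A polynomial in two variables, of total degree at most `t`, has at most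
`t * q - e * (t - e)` zeros, where `e` is its degree in the second variable. -/
theorem card_zeros_add_le [Fintype K] {g : Polynomial (Polynomial K)} (hg : g ≠ 0) {t : ℕ}
    (ht : t ≤ Fintype.card K) (hdeg : ∀ i j, t < i + j → (g.coeff j).coeff i = 0) :
    Nat.card {x : K × K // (g.map (Polynomial.evalRingHom x.1)).eval x.2 = 0} +
      g.natDegree * (t - g.natDegree) ≤ t * Fintype.card K := by
  classical
  set e := g.natDegree with he
  set a := g.leadingCoeff with ha
  have ha0 : a ≠ 0 := Polynomial.leadingCoeff_ne_zero.2 hg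
  have hae : a.natDegree + e ≤ t := by
    by_contra! h
    have := hdeg a.natDegree e h
    exact ha0 (Polynomial.leadingCoeff_eq_zero.1 this)
  have hcard : Nat.card {x : K × K // (g.map (Polynomial.evalRingHom x.1)).eval x.2 = 0} =
      ∑ x : K, (Finset.univ.filter
        fun y => (g.map (Polynomial.evalRingHom x)).eval y = 0).card := by
    rw [Nat.card_eq_fintype_card, Fintype.card_subtype, Finset.card_filter,
      Fintype.sum_prod_type]
    simp only [Finset.card_filter]
  have hfib : ∀ x : K, (Finset.univ.filter
      fun y => (g.map (Polynomial.evalRingHom x)).eval y = 0).card ≤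
      e + if a.eval x = 0 then Fintype.card K - e else 0 := by
    intro x
    split_ifs with h
    · have : (Finset.univ.filter
        fun y => (g.map (Polynomial.evalRingHom x)).eval y = 0).card ≤ Fintype.card K :=
        Finset.card_le_univ _
      omega
    · have h0 : g.map (Polynomial.evalRingHom x) ≠ 0 := by
        intro h0
        apply h
        have h1 : (g.map (Polynomial.evalRingHom x)).coeff e = 0 := by simp [h0]
        rwa [Polynomial.coeff_map] at h1
      calc _ ≤ (g.map (Polynomial.evalRingHom x)).roots.toFinset.card := by
            apply Finset.card_le_card
            intro y hy
            simpa [h0] using hy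
        _ ≤ _ := Multiset.toFinset_card_le _
        _ ≤ _ := Polynomial.card_roots' _
        _ ≤ e := Polynomial.natDegree_map_le
        _ = _ := by simp
  have hroots : (Finset.univ.filter fun x => a.eval x = 0).card ≤ t - e := by
    calc _ ≤ a.roots.toFinset.card := by
            apply Finset.card_le_card
            intro y hy
            simpa [ha0] using hy
        _ ≤ _ := Multiset.toFinset_card_le _
        _ ≤ _ := Polynomial.card_roots' _
        _ ≤ _ := by omega
  have hsum := Finset.sum_le_sum fun x (_ : x ∈ Finset.univ) => hfib x
  rw [← hcard, Finset.sum_add_distrib, ← Finset.sum_filter, Finset.sum_const,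
    Finset.sum_const, Finset.card_univ, smul_eq_mul, smul_eq_mul] at hsum
  have hmul := Nat.mul_le_mul_right (Fintype.card K - e) hroots
  obtain ⟨c, hc⟩ := Nat.exists_eq_add_of_le (show e ≤ t by omega)
  obtain ⟨b, hb⟩ := Nat.exists_eq_add_of_le ht
  have h1 : t - e = c := by omega
  have h2 : Fintype.card K - e = c + b := by omega
  rw [h1, h2] at hmul
  rw [h1]
  rw [h2] at hsum
  rw [hb, hc] at hsum ⊢
  nlinarith

/-- The pullback of a form along the linear parametrization `x ↦ ∑ xₖ eₖ`. -/
noncomputable def pullback {n m : ℕ} (e : Fin n → Fin m → K) (F : MvPolynomial (Fin m) K) :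
    MvPolynomial (Fin n) K :=
  aeval (fun i => linForm fun k => e k i) F

theorem eval_linForm {n : ℕ} (a x : Fin n → K) : eval x (linForm a) = ∑ i, a i * x i := by
  simp [linForm]

theorem isHomogeneous_linForm {n : ℕ} (a : Fin n → K) : (linForm a).IsHomogeneous 1 := by
  apply IsHomogeneous.sum
  intro i _
  simpa using (isHomogeneous_C (Fin n) (a i)).mul (isHomogeneous_X K i)

theorem eval_pullback {n m : ℕ} (e : Fin n → Fin m → K) (F : MvPolynomial (Fin m) K)
    (x : Fin n → K) : eval x (pullback e F) = eval (∑ k, x k • e k) F := by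
  have h : (eval x).comp (aeval fun i => linForm fun k => e k i).toRingHom =
      eval (∑ k, x k • e k) := by
    apply MvPolynomial.ringHom_ext
    · simp
    · intro i
      simp [eval_linForm, mul_comm]
  exact RingHom.congr_fun h F

theorem isHomogeneous_pullback {n m d : ℕ} (e : Fin n → Fin m → K)
    {F : MvPolynomial (Fin m) K} (hF : F.IsHomogeneous d) :
    (pullback e F).IsHomogeneous d := by
  have h := hF.aeval (fun i => linForm fun k => e k i) fun i => isHomogeneous_linForm _
  rwa [one_mul] at h

theorem sum_eq_of_isHomogeneous {n d : ℕ} {F : MvPolynomial (Fin n) K}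
    (hF : F.IsHomogeneous d) {m : Fin n →₀ ℕ} (hm : coeff m F ≠ 0) : ∑ i, m i = d := by
  simpa [Finsupp.weight_apply, Finsupp.sum_fintype] using hF hm

theorem eval_smul_of_isHomogeneous {n d : ℕ} {F : MvPolynomial (Fin n) K}
    (hF : F.IsHomogeneous d) (c : K) (v : Fin n → K) :
    eval (c • v) F = c ^ d * eval v F := by
  rw [eval_eq', eval_eq', Finset.mul_sum]
  apply Finset.sum_congr rfl
  intro m hm
  simp only [Pi.smul_apply, smul_eq_mul, mul_pow, Finset.prod_mul_distrib,
    Finset.prod_pow_eq_pow_sum, sum_eq_of_isHomogeneous hF (mem_support_iff.1 hm)]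
  ring

theorem eval_smul_eq_zero {n d : ℕ} {F : MvPolynomial (Fin n) K} (hF : F.IsHomogeneous d)
    {v : Fin n → K} (hv : eval v F = 0) (c : K) : eval (c • v) F = 0 := by
  rw [eval_smul_of_isHomogeneous hF, hv, mul_zero]

theorem eval_smul_eq_zero_iff {n d : ℕ} {F : MvPolynomial (Fin n) K} (hF : F.IsHomogeneous d)
    {v : Fin n → K} {c : K} (hc : c ≠ 0) : eval (c • v) F = 0 ↔ eval v F = 0 := by
  rw [eval_smul_of_isHomogeneous hF, mul_eq_zero, or_iff_right (pow_ne_zero _ hc)]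

theorem linForm_dvd_of_forall_eval_eq_zero [Fintype K] {n d : ℕ} {F : MvPolynomial (Fin n) K}
    (hF : F.IsHomogeneous d) (hd : d ≤ Fintype.card K) {a : Fin n → K} (ha : a ≠ 0)
    (h : ∀ v, ∑ i, a i * v i = 0 → eval v F = 0) : linForm a ∣ F := by
  classical
  obtain ⟨k, hk⟩ := Function.ne_iff.1 ha
  let b : Fin n → K := Pi.single k (a k)⁻¹
  let s : Fin n → MvPolynomial (Fin n) K := fun j => X j - C (b j) * linForm a
  have hs : ∀ j, (s j).IsHomogeneous 1 := fun j =>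
    (isHomogeneous_X K j).sub (by
      simpa using (isHomogeneous_C (Fin n) (b j)).mul (isHomogeneous_linForm a))
  have hs0 : aeval s F = 0 := by
    have hhom : (aeval s F).IsHomogeneous d := by
      have := hF.aeval s hs
      rwa [one_mul] at this
    refine hhom.eq_zero_of_forall_eval_eq_zero_of_le_card (fun v => ?_) (by simpa using hd)
    have hcomp : (eval v).comp (aeval s).toRingHom =
        eval (v - (∑ i, a i * v i) • b) := by
      apply MvPolynomial.ringHom_ext
      · simp
      · intro i
        simp [s, eval_linForm, mul_comm]
    have := RingHom.congr_fun hcomp F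
    refine this.trans (h _ ?_)
    have hb : ∑ i, a i * b i = 1 := by
      simp only [b, Pi.single_apply, mul_ite, mul_zero, Finset.sum_ite_eq', Finset.mem_univ,
        if_true]
      exact mul_inv_cancel₀ hk
    have : ∀ c : K, ∑ i, a i * (v - c • b) i = ∑ i, a i * v i - c * ∑ i, a i * b i := by
      intro c
      rw [Finset.mul_sum, ← Finset.sum_sub_distrib]
      exact Finset.sum_congr rfl fun i _ => by simp; ring
    rw [this, hb]
    ring
  have hcomp : (Ideal.Quotient.mk (Ideal.span {linForm a})).comp (aeval s).toRingHom =
      Ideal.Quotient.mk (Ideal.span {linForm a}) := by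
    apply MvPolynomial.ringHom_ext
    · simp
    · intro i
      have : Ideal.Quotient.mk (Ideal.span {linForm a}) (linForm a) = 0 :=
        Ideal.Quotient.eq_zero_iff_mem.2 (Ideal.mem_span_singleton_self _)
      simp [s, this]
  have := RingHom.congr_fun hcomp F
  rw [← Ideal.mem_span_singleton, ← Ideal.Quotient.eq_zero_iff_mem, ← this]
  change Ideal.Quotient.mk _ (aeval s F) = 0
  rw [hs0, map_zero]

theorem mem_of_finrank_add_one_eq {V : Type*} [AddCommGroup V] [Module K V]
    [FiniteDimensional K V] {l : Submodule K V} {f : V →ₗ[K] K} (hf : f ≠ 0)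
    (hl : Module.finrank K l + 2 = Module.finrank K V) (hlf : l ≤ LinearMap.ker f) {w : V}
    (hw : w ∉ l) (hwf : f w = 0) {v : V} (hv : f v = 0) : ∃ u ∈ l, ∃ c : K, v = u + c • w := by
  have hle : l ⊔ K ∙ w ≤ LinearMap.ker f := sup_le hlf (by simpa using hwf)
  have hlt : l < l ⊔ K ∙ w := by
    refine lt_of_le_of_ne le_sup_left fun h => hw ?_
    rw [h]
    exact Submodule.mem_sup_right (Submodule.mem_span_singleton_self w)
  have h1 := Submodule.finrank_lt_finrank_of_lt hlt
  have h2 := Module.Dual.finrank_ker_add_one_of_ne_zero hf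
  have heq := Submodule.eq_of_le_of_finrank_le hle (by omega)
  have hv' : v ∈ l ⊔ K ∙ w := heq ▸ (LinearMap.mem_ker.2 hv)
  obtain ⟨u, hu, z, hz, rfl⟩ := Submodule.mem_sup.1 hv'
  obtain ⟨c, rfl⟩ := Submodule.mem_span_singleton.1 hz
  exact ⟨u, hu, c, rfl⟩

theorem linMap_apply {n : ℕ} (a v : Fin n → K) : linMap a v = ∑ i, a i * v i := by
  simp [linMap]

theorem exists_add_eval_ne_zero [Fintype K] {d : ℕ} {F : MvPolynomial (Fin 4) K}
    (hF : F.IsHomogeneous d) (hd : d ≤ Fintype.card K)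
    (hplane : ¬ ∃ a : Fin 4 → K, a ≠ 0 ∧ linForm a ∣ F) {l : Submodule K (Fin 4 → K)}
    (hl : Module.finrank K l = 2) (hl0 : ∀ u ∈ l, eval u F = 0) {w : Fin 4 → K} (hw : w ∉ l) :
    ∃ u ∈ l, eval (u + w) F ≠ 0 := by
  by_contra! h
  have hlt : l ⊔ K ∙ w < ⊤ := by
    apply Submodule.lt_top_of_finrank_lt_finrank
    have := Submodule.finrank_add_le_finrank_add_finrank l (K ∙ w)
    have h1 := finrank_span_le_card (R := K) ({w} : Set (Fin 4 → K))
    simp at h1 ⊢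
    omega
  obtain ⟨f, hf, hlf⟩ := Submodule.exists_le_ker_of_lt_top _ hlt
  set a : Fin 4 → K := fun i => f (Pi.single i 1) with ha
  have hfa : ∀ v, f v = ∑ i, a i * v i := by
    intro v
    conv_lhs => rw [← Finset.univ_sum_single v]
    rw [map_sum]
    refine Finset.sum_congr rfl fun i _ => ?_
    rw [ha, mul_comm, ← smul_eq_mul, ← map_smul, ← Pi.single_smul, smul_eq_mul, mul_one]
  refine hplane ⟨a, fun h0 => hf ?_, linForm_dvd_of_forall_eval_eq_zero hF hd
    (fun h0 => hf ?_) fun v hv => ?_⟩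
  · ext v; simp [hfa, h0]
  · ext v; simp [hfa, h0]
  · rw [← hfa] at hv
    obtain ⟨u, hu, c, rfl⟩ := mem_of_finrank_add_one_eq hf (by simp [hl])
      (le_sup_left.trans hlf) hw
      (hlf (Submodule.mem_sup_right (Submodule.mem_span_singleton_self w))) hv
    by_cases hc : c = 0
    · simpa [hc] using hl0 u hu
    · have := eval_smul_eq_zero hF (h (c⁻¹ • u) (l.smul_mem _ hu)) c
      rwa [smul_add, smul_inv_smul₀ hc] at this

/-- The polar form `w ↦ ∑ ∂ᵢF(Q) wᵢ` of `F` at `Q`. -/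
noncomputable def polar {n : ℕ} (F : MvPolynomial (Fin n) K) (Q : Fin n → K) :
    (Fin n → K) →ₗ[K] K :=
  linMap fun i => eval Q (pderiv i F)

theorem coeff_zero_restrict {n : ℕ} (F : MvPolynomial (Fin n) K) (Q w : Fin n → K) :
    (aeval (fun i => Polynomial.C (Q i) + Polynomial.C (w i) * Polynomial.X) F).coeff 0 =
      eval Q F := by
  induction F using MvPolynomial.induction_on with
  | C a => simp
  | add p q hp hq => simp [hp, hq]
  | mul_X p i hp => simp [Polynomial.mul_coeff_zero, hp]

theorem coeff_one_restrict {n : ℕ} (F : MvPolynomial (Fin n) K) (Q w : Fin n → K) :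
    (aeval (fun i => Polynomial.C (Q i) + Polynomial.C (w i) * Polynomial.X) F).coeff 1 =
      polar F Q w := by
  classical
  simp only [polar, linMap_apply]
  induction F using MvPolynomial.induction_on with
  | C a => simp
  | add p q hp hq => simp [hp, hq, add_mul, Finset.sum_add_distrib]
  | mul_X p i hp =>
    rw [map_mul, aeval_X, mul_add, Polynomial.coeff_add, Polynomial.coeff_mul_C, hp, ← mul_assoc,
      Polynomial.coeff_mul_X, Polynomial.coeff_mul_C, coeff_zero_restrict]
    simp only [Derivation.leibniz, pderiv_X, smul_eq_mul, map_add, map_mul, eval_X, add_mul,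
      Finset.sum_add_distrib, Finset.sum_mul]
    rw [add_comm]
    congr 1
    · rw [Finset.sum_eq_single i]
      · simp
      · intro j _ hj
        simp [hj.symm]
      · simp
    · exact Finset.sum_congr rfl fun j _ => by ring

theorem aeval_pullback {n m : ℕ} {A : Type*} [CommRing A] [Algebra K A]
    (e : Fin n → Fin m → K) (F : MvPolynomial (Fin m) K) (x : Fin n → A) :
    aeval x (pullback e F) = aeval (fun i => ∑ k, algebraMap K A (e k i) * x k) F := by
  have h : (aeval x).comp (aeval fun i => linForm fun k => e k i) =
      aeval (fun i => ∑ k, algebraMap K A (e k i) * x k) := by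
    apply MvPolynomial.algHom_ext
    intro i
    simp [linForm]
  exact AlgHom.congr_fun h F

theorem coeff_pullback_eq_zero [Fintype K] {n t : ℕ} {F : MvPolynomial (Fin n) K}
    (hF : F.IsHomogeneous (t + 1)) (hd : t + 1 ≤ Fintype.card K)
    {e : Fin 3 → Fin n → K} (h : ∀ x y : K, eval (x • e 0 + y • e 1) F = 0)
    {m : Fin 3 →₀ ℕ} (hm : m 2 = 0) : coeff m (pullback e F) = 0 := by
  classical
  have hdvd := linForm_dvd_of_forall_eval_eq_zero (isHomogeneous_pullback e hF) hd
    (a := Pi.single 2 1) (by simp) (fun v hv => by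
      have h2 : v 2 = 0 := by simpa [Pi.single_apply] using hv
      simpa [eval_pullback, Fin.sum_univ_three, h2] using h (v 0) (v 1))
  obtain ⟨G, hG⟩ := hdvd
  have hX : linForm (Pi.single 2 1 : Fin 3 → K) = X 2 := by
    simp [linForm, Pi.single_apply]
  rw [hG, hX, coeff_X_mul', if_neg (by simp [hm])]

/-- The affine equation of the section of `F` by the plane spanned by `e₀, e₁, e₂`, away from the
line spanned by `e₀, e₁`. -/
noncomputable def affineSection {n : ℕ} (F : MvPolynomial (Fin n) K) (e : Fin 3 → Fin n → K) :
    Polynomial (Polynomial K) :=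
  ∑ m ∈ (pullback e F).support,
    Polynomial.monomial (m 1) (Polynomial.monomial (m 0) (coeff m (pullback e F)))

theorem eval_affineSection {n : ℕ} (F : MvPolynomial (Fin n) K) (e : Fin 3 → Fin n → K)
    (x y : K) : ((affineSection F e).map (Polynomial.evalRingHom x)).eval y =
      eval (x • e 0 + y • e 1 + e 2) F := by
  have : x • e 0 + y • e 1 + e 2 = ∑ k, (![x, y, 1] : Fin 3 → K) k • e k := by
    simp [Fin.sum_univ_three]
  rw [this, ← eval_pullback, eval_eq', affineSection, Polynomial.map_sum,
    Polynomial.eval_finsetSum]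
  refine Finset.sum_congr rfl fun m _ => ?_
  simp [Fin.prod_univ_three, mul_assoc]

theorem coeff_affineSection {n : ℕ} (F : MvPolynomial (Fin n) K) (e : Fin 3 → Fin n → K)
    (i j : ℕ) : ((affineSection F e).coeff j).coeff i =
      ∑ m ∈ (pullback e F).support,
        if m 1 = j ∧ m 0 = i then coeff m (pullback e F) else 0 := by
  rw [affineSection, Polynomial.finsetSum_coeff, Polynomial.finsetSum_coeff]
  refine Finset.sum_congr rfl fun m _ => ?_
  rw [Polynomial.coeff_monomial]
  by_cases h : m 1 = j <;> simp [h, Polynomial.coeff_monomial]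

theorem coeff_affineSection_eq_zero [Fintype K] {n t : ℕ} {F : MvPolynomial (Fin n) K}
    (hF : F.IsHomogeneous (t + 1)) (hd : t + 1 ≤ Fintype.card K)
    {e : Fin 3 → Fin n → K} (h : ∀ x y : K, eval (x • e 0 + y • e 1) F = 0) (i j : ℕ)
    (hij : t < i + j) : ((affineSection F e).coeff j).coeff i = 0 := by
  rw [coeff_affineSection]
  refine Finset.sum_eq_zero fun m hm => ?_
  split_ifs with hmij
  · have := sum_eq_of_isHomogeneous (isHomogeneous_pullback e hF) (mem_support_iff.1 hm)
    rw [Fin.sum_univ_three] at this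
    exact coeff_pullback_eq_zero hF hd h (by omega)
  · rfl

theorem coeff_affineSection_eq_polar {n t : ℕ} {F : MvPolynomial (Fin n) K}
    (hF : F.IsHomogeneous (t + 1)) (e : Fin 3 → Fin n → K) :
    ((affineSection F e).coeff t).coeff 0 = polar F (e 1) (e 2) := by
  have h := aeval_pullback e F (![0, 1, Polynomial.X] : Fin 3 → Polynomial K)
  simp only [Fin.sum_univ_three, Matrix.cons_val_zero, mul_zero, zero_add, Matrix.cons_val_one,
    mul_one, Matrix.cons_val, Polynomial.algebraMap_eq] at h
  rw [← coeff_one_restrict, ← h, coeff_affineSection, aeval_def, eval₂_eq',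
    Polynomial.finsetSum_coeff]
  refine Finset.sum_congr rfl fun m hm => ?_
  have hs := sum_eq_of_isHomogeneous (isHomogeneous_pullback e hF) (mem_support_iff.1 hm)
  rw [Fin.sum_univ_three] at hs
  rw [Fin.prod_univ_three]
  by_cases h0 : m 0 = 0
  · simp only [h0, and_true, Matrix.cons_val_zero, Matrix.cons_val_one, Matrix.cons_val,
      pow_zero, one_pow, one_mul, Polynomial.algebraMap_eq, Polynomial.coeff_C_mul_X_pow]
    congr 1
    exact propext (by omega)
  · simp [h0]

theorem exists_equiv_of_finrank_eq_two {V : Type*} [AddCommGroup V] [Module K V]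
    {l : Submodule K V} (hl : Module.finrank K l = 2) {Q : V} (hQ : Q ∈ l) (hQ0 : Q ≠ 0) :
    ∃ P ∈ l, ∃ f : K × K ≃ l, ∀ x, (f x : V) = x.1 • P + x.2 • Q := by
  have hfin : FiniteDimensional K l := FiniteDimensional.of_finrank_pos (by omega)
  obtain ⟨P, hP⟩ : ∃ P : l, P ∉ K ∙ (⟨Q, hQ⟩ : l) := by
    by_contra! h
    have h1 : K ∙ (⟨Q, hQ⟩ : l) = ⊤ := Submodule.eq_top_iff'.2 h
    have h2 := finrank_span_le_card (R := K) ({⟨Q, hQ⟩} : Set l)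
    rw [h1, finrank_top, hl] at h2
    simp at h2
  have hli : LinearIndependent K ![P, ⟨Q, hQ⟩] := by
    rw [LinearIndependent.pair_iff]
    intro s t h
    have hs : s = 0 := by
      by_contra hs
      refine hP (Submodule.mem_span_singleton.2 ⟨-(s⁻¹ * t), ?_⟩)
      rw [add_eq_zero_iff_eq_neg] at h
      rw [neg_smul, mul_smul, ← smul_neg, ← h, inv_smul_smul₀ hs]
    subst hs
    simpa [← Subtype.val_inj, hQ0] using h
  let b := basisOfLinearIndependentOfCardEqFinrank hli (by simp [hl])
  refine ⟨P, P.2, (finTwoArrowEquiv K).symm.trans b.equivFun.symm.toEquiv, fun x => ?_⟩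
  simp [b, Module.Basis.equivFun_symm_apply, Fin.sum_univ_two]

section Coset

variable [Fintype K] {t : ℕ} {F : MvPolynomial (Fin 4) K} {l : Submodule K (Fin 4 → K)}
  {w Q : Fin 4 → K}

theorem exists_affineSection (hF : F.IsHomogeneous (t + 1)) (hd : t + 1 ≤ Fintype.card K)
    (hplane : ¬ ∃ a : Fin 4 → K, a ≠ 0 ∧ linForm a ∣ F) (hl : Module.finrank K l = 2)
    (hl0 : ∀ u ∈ l, eval u F = 0) (hw : w ∉ l) (hQ : Q ∈ l) (hQ0 : Q ≠ 0) :
    ∃ P ∈ l, (∀ u ∈ l, ∃ x y : K, u = x • P + y • Q) ∧ affineSection F ![P, Q, w] ≠ 0 ∧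
      Nat.card {u : l // eval (u.1 + w) F = 0} +
        (affineSection F ![P, Q, w]).natDegree * (t - (affineSection F ![P, Q, w]).natDegree) ≤
        t * Fintype.card K ∧
      ∀ i j, t < i + j → ((affineSection F ![P, Q, w]).coeff j).coeff i = 0 := by
  obtain ⟨P, hP, f, hf⟩ := exists_equiv_of_finrank_eq_two hl hQ hQ0
  have hsurj : ∀ u ∈ l, ∃ x y : K, u = x • P + y • Q := fun u hu =>
    ⟨(f.symm ⟨u, hu⟩).1, (f.symm ⟨u, hu⟩).2, by rw [← hf, Equiv.apply_symm_apply]⟩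
  have hne : affineSection F ![P, Q, w] ≠ 0 := by
    obtain ⟨u, hu, hne⟩ := exists_add_eval_ne_zero hF hd hplane hl hl0 hw
    obtain ⟨x, y, rfl⟩ := hsurj u hu
    intro h0
    have := eval_affineSection F ![P, Q, w] x y
    rw [h0] at this
    exact hne (by simpa using this.symm)
  have hdeg := coeff_affineSection_eq_zero hF hd (e := ![P, Q, w])
    (fun x y => hl0 _ (l.add_mem (l.smul_mem _ hP) (l.smul_mem _ hQ)))
  refine ⟨P, hP, hsurj, hne, ?_, hdeg⟩
  have hcard : Nat.card {u : l // eval (u.1 + w) F = 0} = Nat.card {x : K × K //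
      ((affineSection F ![P, Q, w]).map (Polynomial.evalRingHom x.1)).eval x.2 = 0} := by
    refine (Nat.card_congr (f.subtypeEquiv fun x => ?_)).symm
    rw [eval_affineSection, hf]
    rfl
  rw [hcard]
  exact card_zeros_add_le hne (by omega) hdeg

theorem natCard_coset_le (hF : F.IsHomogeneous (t + 1)) (hd : t + 1 ≤ Fintype.card K)
    (hplane : ¬ ∃ a : Fin 4 → K, a ≠ 0 ∧ linForm a ∣ F) (hl : Module.finrank K l = 2)
    (hl0 : ∀ u ∈ l, eval u F = 0) (hw : w ∉ l) :
    Nat.card {u : l // eval (u.1 + w) F = 0} ≤ t * Fintype.card K := by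
  have : Nontrivial l := Module.nontrivial_of_finrank_pos (R := K) (by omega)
  obtain ⟨Q, hQ⟩ := exists_ne (0 : l)
  obtain ⟨P, -, -, -, h, -⟩ := exists_affineSection hF hd hplane hl hl0 hw Q.2
    (by simpa using hQ)
  omega

theorem eval_add_smul_eq_zero_of_polar (hF : F.IsHomogeneous (t + 1)) (ht : 0 < t)
    (hd : t + 1 ≤ Fintype.card K)
    (hplane : ¬ ∃ a : Fin 4 → K, a ≠ 0 ∧ linForm a ∣ F) (hl : Module.finrank K l = 2)
    (hl0 : ∀ u ∈ l, eval u F = 0) (hw : w ∉ l)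
    (hcard : Nat.card {u : l // eval (u.1 + w) F = 0} = t * Fintype.card K)
    (hQ : Q ∈ l) (hQ0 : Q ≠ 0) (hpolar : polar F Q w = 0) {u : Fin 4 → K} (hu : u ∈ l)
    (h : eval (u + w) F = 0) (c : K) : eval (u + w + c • Q) F = 0 := by
  obtain ⟨P, -, hsurj, hne, hle, hdeg⟩ := exists_affineSection hF hd hplane hl hl0 hw hQ hQ0
  set g := affineSection F ![P, Q, w] with hg
  have hcoeff : ∀ j, t ≤ j → g.coeff j = 0 := by
    intro j hj
    ext i
    by_cases hij : t < i + j
    · simpa using hdeg i j hij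
    · obtain rfl : j = t := by omega
      obtain rfl : i = 0 := by omega
      simpa [hpolar] using coeff_affineSection_eq_polar hF ![P, Q, w]
  have hlt : g.natDegree < t := by
    by_contra! h
    exact hne (Polynomial.leadingCoeff_eq_zero.1 (hcoeff _ h))
  have h0 : g.natDegree = 0 := by
    have : g.natDegree * (t - g.natDegree) = 0 := by omega
    rcases Nat.mul_eq_zero.1 this with h | h
    · exact h
    · omega
  rw [Polynomial.natDegree_eq_zero] at h0
  obtain ⟨a, ha⟩ := h0
  obtain ⟨x, y, rfl⟩ := hsurj u hu
  have h1 := eval_affineSection F ![P, Q, w] x y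
  have h2 := eval_affineSection F ![P, Q, w] x (y + c)
  rw [← hg, ← ha, Polynomial.map_C, Polynomial.eval_C] at h1 h2
  have : x • P + y • Q + w + c • Q = x • P + (y + c) • Q + w := by module
  rw [this]
  exact h2.symm.trans (h1.trans h)

end Coset

theorem card_add_smul_le [Fintype K] {n d : ℕ} {F : MvPolynomial (Fin n) K}
    (hF : F.IsHomogeneous d) {Q w : Fin n → K} (h : (∃ c : K, eval (w + c • Q) F ≠ 0) ∨ eval Q F ≠ 0) :
    Nat.card {c : K // eval (w + c • Q) F = 0} ≤ d ∧
      (eval Q F = 0 → Nat.card {c : K // eval (w + c • Q) F = 0} ≤ d - 1) := by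
  classical
  set G := pullback ![Q, w] F with hG
  let p : Polynomial K := ∑ m ∈ G.support, Polynomial.monomial (m 0) (coeff m G)
  have hsum : ∀ m ∈ G.support, m 0 + m 1 = d := fun m hm => by
    simpa using sum_eq_of_isHomogeneous (isHomogeneous_pullback _ hF) (mem_support_iff.1 hm)
  have hp : ∀ c, p.eval c = eval (w + c • Q) F := by
    intro c
    have : w + c • Q = ∑ k, (![c, 1] : Fin 2 → K) k • (![Q, w] : Fin 2 → Fin n → K) k := by
      simp [add_comm]
    rw [this, ← eval_pullback, eval_eq', Polynomial.eval_finsetSum]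
    exact Finset.sum_congr rfl fun m _ => by simp [hG]
  have hdeg : p.natDegree ≤ d := Polynomial.natDegree_sum_le_of_forall_le _ _ fun m hm =>
    (Polynomial.natDegree_monomial_le _).trans (by have := hsum m hm; omega)
  have hlead : p.coeff d = eval Q F := by
    have : Q = ∑ k, (![1, 0] : Fin 2 → K) k • (![Q, w] : Fin 2 → Fin n → K) k := by simp
    conv_rhs => rw [this, ← eval_pullback, eval_eq']
    rw [Polynomial.finsetSum_coeff]
    refine Finset.sum_congr rfl fun m hm => ?_
    have := hsum m hm
    rw [Polynomial.coeff_monomial]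
    by_cases h1 : m 1 = 0
    · rw [if_pos (by omega)]
      simp [hG, h1]
    · rw [if_neg (by omega)]
      simp [h1]
  have hp0 : p ≠ 0 := by
    rintro h0
    rcases h with ⟨c, hc⟩ | h
    · exact hc (by rw [← hp, h0, Polynomial.eval_zero])
    · exact h (by rw [← hlead, h0, Polynomial.coeff_zero])
  have hcard : Nat.card {c : K // eval (w + c • Q) F = 0} ≤ p.natDegree := by
    rw [Nat.card_eq_fintype_card, Fintype.card_subtype]
    calc _ ≤ p.roots.toFinset.card := by
            apply Finset.card_le_card
            intro y hy
            simpa [hp0, hp] using hy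
        _ ≤ _ := Multiset.toFinset_card_le _
        _ ≤ _ := Polynomial.card_roots' _
  refine ⟨hcard.trans hdeg, fun hQ => hcard.trans ?_⟩
  have : p.natDegree ≠ d ∨ d = 0 := by
    by_contra! h
    apply hp0
    rw [← Polynomial.leadingCoeff_eq_zero, Polynomial.leadingCoeff, h.1, hlead, hQ]
  omega

/-- `I` is the incidence relation of a generalized quadrangle of order `(s, t)`. -/
structure IsGeneralizedQuadrangle {P L : Type*} (I : P → L → Prop) (s t : ℕ) : Prop where
  natCard_points : ∀ l, Nat.card {p // I p l} = s + 1
  natCard_lines : ∀ p, Nat.card {l // I p l} = t + 1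
  line_unique : ∀ {p r l m}, p ≠ r → I p l → I r l → I p m → I r m → l = m
  exists_transversal : ∀ {p l}, ¬ I p l → ∃ m, I p m ∧ ∃ r, I r m ∧ I r l
  transversal_unique : ∀ {p l m n}, ¬ I p l → I p m → (∃ r, I r m ∧ I r l) → I p n →
    (∃ r, I r n ∧ I r l) → m = n

/-- Two distinct lines of an incidence structure are concurrent. -/
def Concur {P L : Type*} (I : P → L → Prop) (l m : L) : Prop :=
  l ≠ m ∧ ∃ p, I p l ∧ I p m

theorem Concur.symm {P L : Type*} {I : P → L → Prop} {l m : L} (h : Concur I l m) :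
    Concur I m l :=
  ⟨h.1.symm, h.2.imp fun _ h => h.symm⟩

namespace IsGeneralizedQuadrangle

variable {P L : Type*} {I : P → L → Prop} {s t : ℕ}

theorem exists_common_point (h : IsGeneralizedQuadrangle I s t) {a b c : L}
    (hab : Concur I a b) (hac : Concur I a c) (hbc : Concur I b c) :
    ∃ p, I p a ∧ I p b ∧ I p c := by
  obtain ⟨p, hpa, hpb⟩ := hab.2
  by_cases hpc : I p c
  · exact ⟨p, hpa, hpb, hpc⟩
  · exact absurd (h.transversal_unique hpc hpa hac.2 hpb hbc.2) hab.1

theorem common_point_unique (h : IsGeneralizedQuadrangle I s t) {a b : L} (hab : a ≠ b)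
    {p r : P} (hpa : I p a) (hpb : I p b) (hra : I r a) (hrb : I r b) : p = r := by
  by_contra hpr
  exact hab (h.line_unique hpr hpa hra hpb hrb)

theorem not_concur_of_transversal (h : IsGeneralizedQuadrangle I s t) {l n m m' : L}
    (hne : l ≠ n) (hln : ¬ Concur I l n) (h1 : Concur I l m) (h2 : Concur I n m)
    (h1' : Concur I l m') (h2' : Concur I n m') : ¬ Concur I m m' := by
  intro hmm
  obtain ⟨p, hpl, hpm, hpm'⟩ := h.exists_common_point h1 h1' hmm
  obtain ⟨r, hrn, hrm, hrm'⟩ := h.exists_common_point h2 h2' hmm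
  obtain rfl := h.common_point_unique hmm.1 hpm hpm' hrm hrm'
  exact hln ⟨hne, p, hpl, hrn⟩

theorem transversal_eq_of_concur (h : IsGeneralizedQuadrangle I s t) {l n m m' x : L}
    (hne : l ≠ n) (hln : ¬ Concur I l n) (h1 : Concur I l m) (h2 : Concur I n m)
    (h1' : Concur I l m') (h2' : Concur I n m') (hx : Concur I l x) (hm : Concur I m x)
    (hm' : Concur I m' x) : m = m' := by
  by_contra hmm
  obtain ⟨p, hpl, hpm, hpx⟩ := h.exists_common_point h1 hx hm
  obtain ⟨r, hrl, hrm, hrx⟩ := h.exists_common_point h1' hx hm'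
  obtain rfl := h.common_point_unique hx.1 hpl hpx hrl hrx
  exact h.not_concur_of_transversal hne hln h1 h2 h1' h2' ⟨hmm, p, hpm, hrm⟩

variable [Fintype P] [Fintype L]

omit [Fintype L] in
open Classical in
theorem card_points (h : IsGeneralizedQuadrangle I s t) (l : L) :
    (Finset.univ.filter fun p => I p l).card = s + 1 := by
  rw [← h.natCard_points l, Nat.card_eq_fintype_card, Fintype.card_subtype]

omit [Fintype P] in
open Classical in
theorem card_lines (h : IsGeneralizedQuadrangle I s t) (p : P) :
    (Finset.univ.filter fun l => I p l).card = t + 1 := by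
  rw [← h.natCard_lines p, Nat.card_eq_fintype_card, Fintype.card_subtype]

theorem card_lines_mul (h : IsGeneralizedQuadrangle I s t) :
    Fintype.card L * (s + 1) = Fintype.card P * (t + 1) := by
  classical
  have := Finset.sum_card_bipartiteAbove_eq_sum_card_bipartiteBelow (s := Finset.univ)
    (t := Finset.univ) (fun (p : P) (l : L) => I p l)
  simp only [Finset.bipartiteAbove, Finset.bipartiteBelow, h.card_points, h.card_lines,
    Finset.sum_const, smul_eq_mul, Finset.card_univ] at this
  exact this.symm

open Classical in
theorem card_concur (h : IsGeneralizedQuadrangle I s t) (l : L) :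
    (Finset.univ.filter fun m => Concur I l m).card = (s + 1) * t := by
  have : (Finset.univ.filter fun m => Concur I l m) =
      (Finset.univ.filter fun p => I p l).biUnion
        fun p => (Finset.univ.filter fun m => I p m).erase l := by
    ext m
    simp only [Finset.mem_filter, Finset.mem_univ, true_and, Finset.mem_biUnion,
      Finset.mem_erase]
    constructor
    · rintro ⟨hne, p, hpl, hpm⟩
      exact ⟨p, hpl, hne.symm, hpm⟩
    · rintro ⟨p, hpl, hne, hpm⟩
      exact ⟨hne.symm, p, hpl, hpm⟩
  rw [this, Finset.card_biUnion]
  · rw [Finset.sum_congr rfl (g := fun _ => t), Finset.sum_const, h.card_points, smul_eq_mul]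
    intro p hp
    rw [Finset.card_erase_of_mem (by simpa using hp), h.card_lines, Nat.add_sub_cancel]
  · intro p hp r hr hpr
    refine Finset.disjoint_left.2 fun m hm hm' => ?_
    simp only [Finset.mem_filter, Finset.mem_univ, true_and, Finset.mem_erase, Finset.coe_filter,
      Set.mem_ofPred_eq] at hp hr hm hm'
    exact hm.1 (h.line_unique hpr hm.2 hm'.2 hp hr)

omit [Fintype P] in
open Classical in
theorem card_concur_concur (h : IsGeneralizedQuadrangle I s t) {l n : L} (hln : Concur I l n) :
    (Finset.univ.filter fun m => Concur I l m ∧ Concur I n m).card = t - 1 := by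
  obtain ⟨p, hpl, hpn⟩ := hln.2
  have : (Finset.univ.filter fun m => Concur I l m ∧ Concur I n m) =
      ((Finset.univ.filter fun m => I p m).erase l).erase n := by
    ext m
    simp only [Finset.mem_filter, Finset.mem_univ, true_and, Finset.mem_erase]
    constructor
    · rintro ⟨h1, h2⟩
      obtain ⟨r, hrl, hrn, hrm⟩ := h.exists_common_point hln h1 h2
      obtain rfl := h.common_point_unique hln.1 hpl hpn hrl hrn
      exact ⟨h2.1.symm, h1.1.symm, hrm⟩
    · rintro ⟨h2, h1, hpm⟩
      exact ⟨⟨Ne.symm h1, p, hpl, hpm⟩, ⟨Ne.symm h2, p, hpn, hpm⟩⟩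
  rw [this, Finset.card_erase_of_mem (by simpa [hpn] using hln.1.symm),
    Finset.card_erase_of_mem (by simpa using hpl), h.card_lines]
  omega

open Classical in
theorem card_transversals (h : IsGeneralizedQuadrangle I s t) {l n : L} (hne : l ≠ n)
    (hln : ¬ Concur I l n) :
    (Finset.univ.filter fun m => Concur I l m ∧ Concur I n m).card = s + 1 := by
  have hskew : ∀ p, I p l → ¬ I p n := fun p hpl hpn => hln ⟨hne, p, hpl, hpn⟩
  rw [← h.card_points l]
  symm
  refine Finset.card_bij
    (fun p hp => (h.exists_transversal (hskew p (by simpa using hp))).choose) ?_ ?_ ?_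
  · intro p hp
    have hp' : I p l := by simpa using hp
    obtain ⟨hm, r, hrm, hrn⟩ := (h.exists_transversal (hskew p hp')).choose_spec
    simp only [Finset.mem_filter, Finset.mem_univ, true_and]
    exact ⟨⟨fun he => hskew r (he ▸ hrm) hrn, p, hp', hm⟩,
      ⟨fun he => hskew p hp' (by rw [he]; exact hm), r, hrn, hrm⟩⟩
  · intro p hp r hr heq
    have hp' : I p l := by simpa using hp
    have hr' : I r l := by simpa using hr
    obtain ⟨hm, x, hxm, hxn⟩ := (h.exists_transversal (hskew p hp')).choose_spec
    obtain ⟨hm', -⟩ := (h.exists_transversal (hskew r hr')).choose_spec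
    rw [← heq] at hm'
    exact h.common_point_unique (fun he => hskew x (by rw [← he]; exact hxm) hxn) hm hp' hm' hr'
  · intro m hm
    simp only [Finset.mem_filter, Finset.mem_univ, true_and] at hm
    obtain ⟨⟨-, p, hpl, hpm⟩, -, r, hrn, hrm⟩ := hm
    refine ⟨p, by simpa using hpl, ?_⟩
    obtain ⟨hm', hx⟩ := (h.exists_transversal (hskew p hpl)).choose_spec
    exact h.transversal_unique (hskew p hpl) hm' hx hpm ⟨r, hrm, hrn⟩

theorem exists_not_concur (h : IsGeneralizedQuadrangle I s t)
    (hP : Fintype.card P = (s + 1) * (s * t + 1)) (hs : 0 < s) (ht : 0 < t) :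
    ∃ l n : L, l ≠ n ∧ ¬ Concur I l n := by
  classical
  have hL : Fintype.card L = (t + 1) * (s * t + 1) := by
    have := h.card_lines_mul
    rw [hP] at this
    apply Nat.eq_of_mul_eq_mul_right (Nat.succ_pos s)
    rw [Nat.succ_eq_add_one, this]
    ring
  have : Nonempty L := Fintype.card_pos_iff.1 (by rw [hL]; positivity)
  obtain ⟨l⟩ := this
  by_contra! hcon
  have hle : Fintype.card L ≤ (s + 1) * t + 1 := by
    rw [← h.card_concur l, ← Finset.card_univ]
    refine le_trans (Finset.card_le_card fun n _ => ?_) (Finset.card_insert_le l _)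
    by_cases hn : l = n
    · simp [hn]
    · simp [hcon l n hn]
  rw [hL] at hle
  have : 0 < s * t * t := by positivity
  nlinarith

/-- Higman's inequality. -/
theorem le_sq (h : IsGeneralizedQuadrangle I s t)
    (hP : Fintype.card P = (s + 1) * (s * t + 1)) (hs : 1 < s) (ht : 1 < t) : s ≤ t ^ 2 := by
  classical
  have hL : (Fintype.card L : ℤ) = (t + 1) * (s * t + 1) := by
    have := h.card_lines_mul
    rw [hP] at this
    have h2 : Fintype.card L = (t + 1) * (s * t + 1) := by
      apply Nat.eq_of_mul_eq_mul_right (Nat.succ_pos s)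
      rw [Nat.succ_eq_add_one, this]
      ring
    exact_mod_cast h2
  obtain ⟨l₁, l₂, hne, hskew⟩ := h.exists_not_concur hP (by omega) (by omega)
  have hskew' : ¬ Concur I l₂ l₁ := fun h' => hskew h'.symm
  let A : L → L → ℤ := fun m n => if Concur I m n then 1 else 0
  have hAcomm : ∀ m n, A m n = A n m := fun m n => by
    have : Concur I m n ↔ Concur I n m := ⟨Concur.symm, Concur.symm⟩
    simp only [A, this]
  have hAself : ∀ m, A m m = 0 := fun m => if_neg fun h => h.1 rfl
  have hA1 : ∀ m, ∑ n, A m n = (s + 1) * t := fun m => by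
    simp only [A]
    rw [Finset.sum_boole, h.card_concur]
    push_cast; rfl
  have hA2 : ∀ m m', ∑ n, A m n * A m' n =
      ((Finset.univ.filter fun n => Concur I m n ∧ Concur I m' n).card : ℤ) := fun m m' => by
    rw [← Finset.sum_boole]
    refine Finset.sum_congr rfl fun n _ => ?_
    by_cases h1 : Concur I m n <;> by_cases h2 : Concur I m' n <;> simp [A, h1, h2]
  set T := Finset.univ.filter fun m => Concur I l₁ m ∧ Concur I l₂ m with hTdef
  have hT : (T.card : ℤ) = s + 1 := by
    rw [hTdef, h.card_transversals hne hskew]; push_cast; rfl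
  have hmemT : ∀ m, m ∈ T ↔ Concur I l₁ m ∧ Concur I l₂ m := fun m => by simp [hTdef]
  let f : L → ℤ := fun m => ∑ n ∈ T, A n m
  have hfsum : ∑ m, f m = (s + 1) * ((s + 1) * t) := by
    simp only [f]
    rw [Finset.sum_comm, Finset.sum_congr rfl fun n _ => hA1 n, Finset.sum_const, nsmul_eq_mul, hT]
  have hTT : ∀ n ∈ T, ∀ n' ∈ T, A n n' = 0 := fun n hn n' hn' => by
    rw [hmemT] at hn hn'
    exact if_neg (h.not_concur_of_transversal hne hskew hn.1 hn.2 hn'.1 hn'.2)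
  have hfsq : ∑ m, f m ^ 2 = (s + 1) * ((s + 1) * t + s * (s + 1)) := by
    have h1 : ∑ m, f m ^ 2 = ∑ n ∈ T, ∑ n' ∈ T, ∑ m, A n m * A n' m := by
      simp only [f, sq, Finset.sum_mul_sum]
      rw [Finset.sum_comm]
      exact Finset.sum_congr rfl fun n _ => Finset.sum_comm
    rw [h1, Finset.sum_congr rfl (g := fun _ => ((s + 1) * t + s * (s + 1) : ℤ)),
      Finset.sum_const, nsmul_eq_mul, hT]
    intro n hn
    rw [← Finset.add_sum_erase _ _ hn, hA2]
    have h2 : ∀ n' ∈ T.erase n, ∑ m, A n m * A n' m = s + 1 := fun n' hn' => by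
      rw [Finset.mem_erase] at hn'
      have hnn : ¬ Concur I n n' := fun hc => by
        have := hTT n hn n' hn'.2
        simp [A, hc] at this
      rw [hA2, h.card_transversals hn'.1.symm hnn]
      push_cast; rfl
    rw [Finset.sum_congr rfl h2, Finset.sum_const, nsmul_eq_mul, Finset.card_erase_of_mem hn]
    have h3 : ((T.card - 1 : ℕ) : ℤ) = s := by omega
    rw [h3]
    simp only [and_self]
    rw [h.card_concur]
    push_cast; rfl
  have hfA : ∀ l, (∀ n ∈ T, Concur I n l) → ∑ m, f m * A l m = (s + 1) * (t - 1) := by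
    intro l hl
    simp only [f, Finset.sum_mul]
    rw [Finset.sum_comm, Finset.sum_congr rfl (g := fun _ => (t - 1 : ℤ)), Finset.sum_const,
      nsmul_eq_mul, hT]
    intro n hn
    rw [hA2, h.card_concur_concur (hl n hn)]
    omega
  have hf1 := hfA l₁ fun n hn => ((hmemT n).1 hn).1.symm
  have hf2 := hfA l₂ fun n hn => ((hmemT n).1 hn).2.symm
  have hfl : ∀ l, (∀ n ∈ T, Concur I n l) → f l = s + 1 := fun l hl => by
    simp only [f]
    rw [Finset.sum_congr rfl (g := fun _ => (1 : ℤ)) fun n hn => if_pos (hl n hn)]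
    simpa using hT
  have hfl1 := hfl l₁ fun n hn => ((hmemT n).1 hn).1.symm
  have hfl2 := hfl l₂ fun n hn => ((hmemT n).1 hn).2.symm
  have hfT : ∀ m, f m * (A l₁ m * A l₂ m) = 0 := fun m => by
    by_cases hm : m ∈ T
    · have : f m = 0 := Finset.sum_eq_zero fun n hn => hTT n hn m hm
      rw [this, zero_mul]
    · have : A l₁ m * A l₂ m = 0 := by
        rw [hmemT] at hm
        by_cases h1 : Concur I l₁ m
        · have h2 : ¬ Concur I l₂ m := fun h2 => hm ⟨h1, h2⟩
          simp [A, h2]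
        · simp [A, h1]
      rw [this, mul_zero]
  have hidem : ∀ l, (∀ m, Concur I l m → f m = 0 ∨ f m = 1) → ∀ m,
      f m ^ 2 * A l m = f m * A l m := fun l hl m => by
    by_cases hm : Concur I l m
    · rcases hl m hm with h0 | h0 <;> simp [h0]
    · simp [A, hm]
  have h01 : ∀ m, (∀ n ∈ T, ∀ n' ∈ T, Concur I n m → Concur I n' m → n = n') →
      f m = 0 ∨ f m = 1 := fun m hm => by
    by_cases hn : ∃ n ∈ T, Concur I n m
    · obtain ⟨n, hn, hnm⟩ := hn
      right
      simp only [f]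
      rw [Finset.sum_eq_single_of_mem n hn]
      · exact if_pos hnm
      · exact fun n' hn' hnn' => if_neg fun hc => hnn' (hm n' hn' n hn hc hnm)
    · push Not at hn
      exact Or.inl (Finset.sum_eq_zero fun n hnT => if_neg (hn n hnT))
  have hidem1 := hidem l₁ fun m hm => h01 m fun n hn n' hn' hnm hnm' => by
    rw [hmemT] at hn hn'
    exact h.transversal_eq_of_concur hne hskew hn.1 hn.2 hn'.1 hn'.2 hm hnm hnm'
  have hidem2 := hidem l₂ fun m hm => h01 m fun n hn n' hn' hnm hnm' => by
    rw [hmemT] at hn hn'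
    exact h.transversal_eq_of_concur hne.symm hskew' hn.2 hn.1 hn'.2 hn'.1 hm hnm hnm'
  set M := Finset.univ.filter fun m => m ≠ l₁ ∧ m ≠ l₂ ∧ ¬ Concur I l₁ m ∧ ¬ Concur I l₂ m
    with hM
  have hind : ∀ m, (if m ≠ l₁ ∧ m ≠ l₂ ∧ ¬ Concur I l₁ m ∧ ¬ Concur I l₂ m then (1 : ℤ) else 0) =
      1 - A l₁ m - A l₂ m + A l₁ m * A l₂ m - (if m = l₁ then 1 else 0) -
        (if m = l₂ then 1 else 0) := fun m => by
    by_cases h1 : m = l₁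
    · subst h1
      simp [A, hne, hskew', show ¬ Concur I m m from fun h => h.1 rfl]
    · by_cases h2 : m = l₂
      · subst h2
        simp [A, hne.symm, hskew, show ¬ Concur I m m from fun h => h.1 rfl]
      · by_cases h3 : Concur I l₁ m <;> by_cases h4 : Concur I l₂ m <;> simp [A, h1, h2, h3, h4]
  have hsumM : ∀ g : L → ℤ, ∑ m ∈ M, g m = ∑ m, g m - ∑ m, g m * A l₁ m - ∑ m, g m * A l₂ m +
      ∑ m, g m * (A l₁ m * A l₂ m) - g l₁ - g l₂ := fun g => by
    have h1 : ∑ m ∈ M, g m = ∑ m, g m * (1 - A l₁ m - A l₂ m + A l₁ m * A l₂ m -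
        (if m = l₁ then 1 else 0) - (if m = l₂ then 1 else 0)) := by
      rw [hM, Finset.sum_filter]
      refine Finset.sum_congr rfl fun m _ => ?_
      rw [← hind m]
      simp
    rw [h1]
    simp only [mul_sub, mul_add, Finset.sum_sub_distrib, Finset.sum_add_distrib, mul_one,
      mul_ite, mul_zero, Finset.sum_ite_eq', Finset.mem_univ, if_true]
  have hcardM : (M.card : ℤ) = (t + 1) * (s * t + 1) - 2 * ((s + 1) * t) + (s + 1) - 2 := by
    have := hsumM fun _ => 1
    simp only [one_mul, hA1, hA2] at this
    rw [h.card_transversals hne hskew] at this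
    simp only [Finset.sum_const, nsmul_eq_mul, mul_one, Finset.card_univ, hL] at this
    rw [this]
    push_cast
    ring
  have hS1 : ∑ m ∈ M, f m = (s + 1) * (s - 1) * t := by
    rw [hsumM, hfsum, hf1, hf2, hfl1, hfl2, Finset.sum_eq_zero fun m _ => hfT m]
    ring
  have hS2 : ∑ m ∈ M, f m ^ 2 = (s + 1) * (s - 1) * (s + t) := by
    rw [hsumM, hfsq, Finset.sum_congr rfl fun m _ => hidem1 m,
      Finset.sum_congr rfl fun m _ => hidem2 m, hf1, hf2, hfl1, hfl2,
      Finset.sum_eq_zero fun m _ => by rw [sq, mul_assoc, hfT m, mul_zero]]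
    ring
  have hCS : (∑ m ∈ M, f m) ^ 2 ≤ M.card * ∑ m ∈ M, f m ^ 2 := sq_sum_le_card_mul_sum_sq
  rw [hS1, hS2, hcardM] at hCS
  have hfac : 0 ≤ ((s + 1) * (s - 1) * s * (t - 1) : ℤ) * (t ^ 2 - s) := by
    linarith
  have hpos : 0 < ((s + 1) * (s - 1) * s * (t - 1) : ℤ) := by
    have h1 : (0 : ℤ) < s - 1 := by omega
    have h2 : (0 : ℤ) < t - 1 := by omega
    have h3 : (0 : ℤ) < s := by omega
    positivity
  have := nonneg_of_mul_nonneg_right hfac hpos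
  zify
  linarith

end IsGeneralizedQuadrangle

open Classical in
/-- Averaging over the cosets of `W`. -/
theorem sum_sum_add {V ι : Type*} [AddCommGroup V] [Module K V] [Fintype V] [Fintype ι]
    (W : Submodule K V) (g : ι → V) (hg : ∀ i, g i ∈ W) (f : V → ℕ) :
    ∑ w with w ∉ W, ∑ i, f (w + g i) = Fintype.card ι * ∑ v with v ∉ W, f v := by
  rw [Finset.sum_comm, Finset.sum_congr rfl (g := fun _ => ∑ v with v ∉ W, f v), Finset.sum_const,
    smul_eq_mul, Finset.card_univ]
  intro i _
  refine Finset.sum_equiv (Equiv.addRight (g i)) (fun v => ?_) fun v _ => rfl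
  simp [Submodule.add_mem_iff_left W (hg i)]

open Classical in
theorem natCard_nonzero_eq_mul [Fintype K] {V : Type*} [AddCommGroup V] [Module K V]
    {p : V → Prop} (hp : ∀ v, ∀ c : K, c ≠ 0 → p v → p (c • v)) :
    Nat.card {v : V // v ≠ 0 ∧ p v} =
      Nat.card {x : Projectivization K V // p x.rep} * (Fintype.card K - 1) := by
  have hp' : ∀ v, ∀ c : Kˣ, p (c • v) ↔ p v := fun v c =>
    ⟨fun h => by simpa [smul_smul, Units.smul_def] using hp _ (c⁻¹ : Kˣ).1 (Units.ne_zero _) h,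
      hp v c.1 c.ne_zero⟩
  have e : {v : V // v ≠ 0 ∧ p v} ≃ {x : Projectivization K V // p x.rep} × Kˣ :=
    (Equiv.subtypeSubtypeEquivSubtypeInter (fun v : V => v ≠ 0) p).symm.trans
      ((Equiv.subtypeEquiv (Projectivization.nonZeroEquivProjectivizationProdUnits K V)
        (q := fun x => p x.1.rep) fun v => by
          have h1 : ((Projectivization.nonZeroEquivProjectivizationProdUnits K V) v).1 =
            Projectivization.mk K v.1 v.2 := rfl
          obtain ⟨a, ha⟩ := Projectivization.exists_smul_eq_mk_rep K v.1 v.2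
          rw [h1, ← ha, hp']).trans
        (Equiv.prodSubtypeFstEquivSubtypeProd (p := fun x : Projectivization K V => p x.rep)))
  rw [Nat.card_congr e, Nat.card_prod, Nat.card_eq_fintype_card (α := Kˣ), Fintype.card_units]

section Lines

variable {V : Type*} [AddCommGroup V] [Module K V] {l m : Submodule K V} {P Q u w : V}

theorem exists_eq_smul_add_smul (hl : Module.finrank K l = 2) (hP : P ∈ l) (hQ : Q ∈ l)
    (hQ0 : Q ≠ 0) (hPQ : ∀ c : K, P ≠ c • Q) (hu : u ∈ l) : ∃ a b : K, u = a • P + b • Q := by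
  obtain ⟨R, -, f, hf⟩ := exists_equiv_of_finrank_eq_two hl hQ hQ0
  have hsurj : ∀ u ∈ l, ∃ x y : K, u = x • R + y • Q := fun u hu =>
    ⟨(f.symm ⟨u, hu⟩).1, (f.symm ⟨u, hu⟩).2, by rw [← hf, Equiv.apply_symm_apply]⟩
  obtain ⟨a, b, rfl⟩ := hsurj P hP
  obtain ⟨x, y, rfl⟩ := hsurj u hu
  have ha : a ≠ 0 := by
    rintro rfl
    exact hPQ b (by simp)
  refine ⟨x / a, y - x / a * b, ?_⟩
  rw [smul_add, smul_smul, div_mul_cancel₀ _ ha, smul_smul]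
  module

theorem eq_of_mem_of_mem (hl : Module.finrank K l = 2) (hm : Module.finrank K m = 2)
    (hPl : P ∈ l) (hQl : Q ∈ l) (hPm : P ∈ m) (hQm : Q ∈ m) (hQ0 : Q ≠ 0)
    (hPQ : ∀ c : K, P ≠ c • Q) : l = m := by
  apply le_antisymm
  · intro u hu
    obtain ⟨a, b, rfl⟩ := exists_eq_smul_add_smul hl hPl hQl hQ0 hPQ hu
    exact m.add_mem (m.smul_mem _ hPm) (m.smul_mem _ hQm)
  · intro u hu
    obtain ⟨a, b, rfl⟩ := exists_eq_smul_add_smul hm hPm hQm hQ0 hPQ hu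
    exact l.add_mem (l.smul_mem _ hPl) (l.smul_mem _ hQl)

theorem finrank_span_pair_eq_two (hQ0 : Q ≠ 0) (hPQ : ∀ c : K, P ≠ c • Q) :
    Module.finrank K (Submodule.span K {P, Q}) = 2 := by
  have hli : LinearIndependent K ![Q, P] := by
    rw [LinearIndependent.pair_iff' hQ0]
    exact fun c h => hPQ c h.symm
  have := finrank_span_eq_card hli
  rwa [Matrix.range_cons, Matrix.range_cons, Matrix.range_empty, Set.union_empty,
    Set.singleton_union, Set.pair_comm, Fintype.card_fin] at this

theorem exists_mem_forall_ne_smul [Fintype K] (hl : Module.finrank K l = 2) (hQ : Q ∈ l)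
    (hQ0 : Q ≠ 0) : ∃ P ∈ l, ∀ c : K, P ≠ c • Q := by
  obtain ⟨P, hP, f, hf⟩ := exists_equiv_of_finrank_eq_two hl hQ hQ0
  refine ⟨P, hP, fun c hc => ?_⟩
  have : f (1, 0) = f (0, c) := Subtype.ext (by simp [hf, hc])
  simpa using congrArg Prod.fst (f.injective this)

end Lines

theorem Projectivization.rep_ne_smul_rep {V : Type*} [AddCommGroup V] [Module K V]
    {p r : Projectivization K V} (h : p ≠ r) (c : K) : p.rep ≠ c • r.rep := by
  intro hc
  apply h
  rw [← p.mk_rep, ← r.mk_rep, Projectivization.mk_eq_mk_iff']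
  exact ⟨c, hc.symm⟩

/-- `F` defines a surface of degree `t + 1 ≤ q` without plane components which has
`(q + 1) * (t * q + 1)` points. -/
structure IsExtremal [Fintype K] (F : MvPolynomial (Fin 4) K) (t : ℕ) : Prop where
  isHomogeneous : F.IsHomogeneous (t + 1)
  pos : 0 < t
  lt_card : t + 1 ≤ Fintype.card K
  not_dvd : ¬ ∃ a : Fin 4 → K, a ≠ 0 ∧ linForm a ∣ F
  natCard_points : Nat.card {p : Projectivization K (Fin 4 → K) // eval p.rep F = 0} =
    (Fintype.card K + 1) * (t * Fintype.card K + 1)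

/-- `l` is a line contained in the surface `F = 0`. -/
def IsLineOn (F : MvPolynomial (Fin 4) K) (l : Submodule K (Fin 4 → K)) : Prop :=
  Module.finrank K l = 2 ∧ ∀ u ∈ l, eval u F = 0

/-- In the plane spanned by `l` and `w`, the affine part `l + w` of the zero set of `F` is
invariant under translation by `Q`. -/
def IsVertex (F : MvPolynomial (Fin 4) K) (l : Submodule K (Fin 4 → K)) (w Q : Fin 4 → K) :
    Prop :=
  ∀ u ∈ l, ∀ c : K, eval (u + w) F = 0 → eval (u + w + c • Q) F = 0

namespace IsExtremal

variable [Fintype K] {t : ℕ} {F : MvPolynomial (Fin 4) K} {l m : Submodule K (Fin 4 → K)}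
  {P Q R u w w' : Fin 4 → K}

theorem eval_zero (hF : IsExtremal F t) : eval 0 F = 0 := by
  have := eval_smul_of_isHomogeneous hF.isHomogeneous 0 0
  simpa using this

theorem smul (hF : IsExtremal F t) (h : eval P F = 0) (c : K) : eval (c • P) F = 0 :=
  eval_smul_eq_zero hF.isHomogeneous h c

open Classical in
theorem card_nonzero (hF : IsExtremal F t) :
    (Finset.univ.filter fun v => v ≠ 0 ∧ eval v F = 0).card =
      (Fintype.card K + 1) * (t * Fintype.card K + 1) * (Fintype.card K - 1) := by
  have h := natCard_nonzero_eq_mul (K := K) (V := Fin 4 → K) (p := fun v => eval v F = 0)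
    fun v c _ h => hF.smul h c
  rw [Nat.card_eq_fintype_card, Fintype.card_subtype, hF.natCard_points] at h
  exact h

open Classical in
theorem card_notMem (W : Submodule K (Fin 4 → K)) :
    (Finset.univ.filter fun w => w ∉ W).card =
      Fintype.card K ^ 4 - Fintype.card K ^ Module.finrank K W := by
  rw [Finset.filter_not, Finset.card_sdiff_of_subset (Finset.filter_subset _ _), Finset.card_univ,
    ← Fintype.card_subtype, Fintype.card_fun, Fintype.card_fin]
  congr 1
  exact Module.card_eq_pow_finrank (K := K) (V := W)

theorem isLineOn_span (hF : IsExtremal F t) (hQ0 : Q ≠ 0) (hQ : eval Q F = 0)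
    (hPQ : ∀ c : K, P ≠ c • Q) (h : ∀ c : K, eval (P + c • Q) F = 0) :
    IsLineOn F (Submodule.span K {P, Q}) := by
  refine ⟨finrank_span_pair_eq_two hQ0 hPQ, fun u hu => ?_⟩
  obtain ⟨a, b, rfl⟩ := Submodule.mem_span_pair.1 hu
  by_cases ha : a = 0
  · simpa [ha] using hF.smul hQ b
  · have := hF.smul (h (a⁻¹ * b)) a
    rwa [smul_add, smul_smul, mul_inv_cancel_left₀ ha] at this

open Classical in
theorem card_zeros_notMem (hF : IsExtremal F t) (hl : ∀ u ∈ l, eval u F = 0) :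
    (Finset.univ.filter fun v => v ∉ l ∧ eval v F = 0).card + Fintype.card K ^ Module.finrank K l =
      (Fintype.card K + 1) * (t * Fintype.card K + 1) * (Fintype.card K - 1) + 1 := by
  have h1 : Fintype.card K ^ Module.finrank K l = (Finset.univ.filter fun v => v ∈ l).card := by
    rw [← Module.card_eq_pow_finrank (K := K) (V := l), ← Fintype.card_subtype]
  have h2 : (Finset.univ.filter fun v : Fin 4 → K => v = 0).card = 1 := by
    rw [Finset.card_eq_one]
    exact ⟨0, by ext; simp⟩
  rw [← hF.card_nonzero, h1, ← h2, ← Finset.card_union_of_disjoint, ← Finset.card_union_of_disjoint]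
  · congr 1
    ext v
    simp only [Finset.mem_union, Finset.mem_filter, Finset.mem_univ, true_and]
    by_cases hv : v ∈ l
    · have := hl v hv
      by_cases hv0 : v = 0 <;> simp_all
    · have hv0 : v ≠ 0 := fun h => hv (h ▸ l.zero_mem)
      simp [hv, hv0]
  · exact Finset.disjoint_filter.2 fun v _ h1 h2 => h1.1 h2
  · exact Finset.disjoint_filter.2 fun v _ h1 h2 => h1.1 h2

theorem exists_line (hF : IsExtremal F t) (hQ : eval Q F = 0) (hQ0 : Q ≠ 0) :
    ∃ l, IsLineOn F l ∧ Q ∈ l := by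
  classical
  by_cases h : ∃ w, (∀ c : K, w ≠ c • Q) ∧ ∀ c : K, eval (w + c • Q) F = 0
  · obtain ⟨w, hw, h⟩ := h
    exact ⟨_, hF.isLineOn_span hQ0 hQ hw h, Submodule.subset_span (by simp)⟩
  · exfalso
    push Not at h
    set W := K ∙ Q with hW
    have hrank : Module.finrank K W = 1 := finrank_span_singleton hQ0
    have hle : ∀ w ∈ Finset.univ.filter (· ∉ W),
        ∑ c : K, (if eval (w + c • Q) F = 0 then 1 else 0) ≤ t := by
      intro w hw
      have hw' : ∀ c : K, w ≠ c • Q := fun c hc => by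
        simp only [Finset.mem_filter, Finset.mem_univ, true_and] at hw
        exact hw (hc ▸ Submodule.smul_mem _ _ (Submodule.mem_span_singleton_self Q))
      have := (card_add_smul_le hF.isHomogeneous (Or.inl (h w hw'))).2 hQ
      rw [Nat.card_eq_fintype_card, Fintype.card_subtype] at this
      simpa using this
    have hsum := Finset.sum_le_sum hle
    rw [sum_sum_add W (fun c : K => c • Q)
      (fun c => Submodule.smul_mem _ _ (Submodule.mem_span_singleton_self Q))
      (fun v => if eval v F = 0 then 1 else 0), Finset.sum_boole, Finset.filter_filter,
      Finset.sum_const, card_notMem, hrank, smul_eq_mul, pow_one] at hsum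
    have hcard := hF.card_zeros_notMem (l := W) fun u hu => by
      obtain ⟨c, rfl⟩ := Submodule.mem_span_singleton.1 hu
      exact hF.smul hQ c
    rw [hrank, pow_one] at hcard
    obtain ⟨r, hr⟩ := Nat.exists_eq_add_of_le hF.lt_card
    set q := Fintype.card K with hq
    have h4 : q ^ 4 - q = q * (q ^ 3 - 1) := by rw [Nat.mul_sub]; ring_nf
    have hq0 : 0 < q := by omega
    rw [h4, mul_assoc] at hsum
    have hsum := Nat.le_of_mul_le_mul_left hsum hq0
    have h3 : 1 ≤ q ^ 3 := Nat.one_le_pow _ _ hq0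
    simp only [Nat.cast_id] at hsum
    zify [h3] at hsum
    zify [show 1 ≤ q from hq0] at hcard hr
    nlinarith [hF.pos]

open Classical in
theorem card_coset (hF : IsExtremal F t) (hl : IsLineOn F l) (hw : w ∉ l) :
    Nat.card {u : l // eval (u.1 + w) F = 0} = t * Fintype.card K := by
  have hle : ∀ w ∈ Finset.univ.filter (· ∉ l),
      ∑ u : l, (if eval (w + u.1) F = 0 then 1 else 0) ≤ t * Fintype.card K := by
    intro w hw
    have := natCard_coset_le hF.isHomogeneous hF.lt_card hF.not_dvd hl.1 hl.2
      (by simpa using hw : w ∉ l)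
    rw [Nat.card_eq_fintype_card, Fintype.card_subtype] at this
    simpa [add_comm w] using this
  have hcard := hF.card_zeros_notMem hl.2
  have hsum := sum_sum_add l (fun u : l => u.1) (fun u => u.2)
      (fun v => if eval v F = 0 then 1 else 0)
  have hcl : Fintype.card l = Fintype.card K ^ 2 := by
    rw [← hl.1]; exact Module.card_eq_pow_finrank
  rw [Finset.sum_boole, Finset.filter_filter, hcl] at hsum
  have heq : ∑ w with w ∉ l, ∑ u : l, (if eval (w + u.1) F = 0 then 1 else 0) =
      ∑ w with w ∉ l, t * Fintype.card K := by
    rw [hsum, Finset.sum_const, card_notMem, smul_eq_mul, hl.1]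
    rw [hl.1] at hcard
    set q := Fintype.card K with hq
    have hq1 : 1 ≤ q := by have := hF.lt_card; omega
    have h4 : q ^ 2 ≤ q ^ 4 := Nat.pow_le_pow_right hq1 (by omega)
    simp only [Nat.cast_id]
    zify [h4]
    zify [hq1] at hcard
    linear_combination (q : ℤ) ^ 2 * hcard
  have := (Finset.sum_eq_sum_iff_of_le hle).1 heq w (by simpa using hw)
  rw [Nat.card_eq_fintype_card, Fintype.card_subtype, ← this]
  simp [add_comm w]

theorem exists_eval_eq_zero (hF : IsExtremal F t) (hl : IsLineOn F l) (hw : w ∉ l) :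
    ∃ u ∈ l, eval (u + w) F = 0 := by
  have h : 0 < Nat.card {u : l // eval (u.1 + w) F = 0} := by
    rw [hF.card_coset hl hw]
    exact Nat.mul_pos hF.pos (by have := hF.lt_card; omega)
  have := (Nat.card_pos_iff.1 h).1
  obtain ⟨u, hu⟩ := this
  exact ⟨u.1, u.2, hu⟩

theorem eq_smul_of_isVertex (hF : IsExtremal F t) (hl : IsLineOn F l) (hw : w ∉ l)
    (hv : IsVertex F l w Q) (hQ : Q ∈ l) (hQ0 : Q ≠ 0) (hR : R ∈ l) (hu : u ∈ l)
    (h : ∀ c : K, eval (u + w + c • R) F = 0) : ∃ c : K, R = c • Q := by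
  by_contra! hRQ
  obtain ⟨z, hz, hne⟩ := exists_add_eval_ne_zero hF.isHomogeneous hF.lt_card hF.not_dvd hl.1 hl.2 hw
  obtain ⟨a, b, hab⟩ := exists_eq_smul_add_smul hl.1 hR hQ hQ0 hRQ (l.sub_mem hz hu)
  have h1 := hv (u + a • R) (l.add_mem hu (l.smul_mem a hR)) b
    (by have := h a; rwa [add_right_comm] at this)
  rw [sub_eq_iff_eq_add] at hab
  have h2 : z + w = u + a • R + w + b • Q := by
    rw [hab]
    abel
  exact hne (h2 ▸ h1)

theorem eq_smul_of_isVertex_of_isVertex (hF : IsExtremal F t) (hl : IsLineOn F l) (hw : w ∉ l)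
    (hv : IsVertex F l w Q) (hQ : Q ∈ l) (hQ0 : Q ≠ 0) (hR : R ∈ l) (hv' : IsVertex F l w R) :
    ∃ c : K, R = c • Q := by
  obtain ⟨u, hu, h0⟩ := hF.exists_eval_eq_zero hl hw
  exact hF.eq_smul_of_isVertex hl hw hv hQ hQ0 hR hu fun c => hv' u hu c h0

theorem isVertex_smul_add (hF : IsExtremal F t) (hu : u ∈ l) {c : K} (hc : c ≠ 0)
    (h : IsVertex F l w Q) : IsVertex F l (c • w + u) Q := by
  intro z hz b h0
  have h1 : z + (c • w + u) = c • (c⁻¹ • (z + u) + w) := by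
    rw [smul_add, smul_inv_smul₀ hc]
    abel
  rw [h1] at h0 ⊢
  rw [eval_smul_eq_zero_iff hF.isHomogeneous hc] at h0
  have := hF.smul (h _ (l.smul_mem _ (l.add_mem hz hu)) (c⁻¹ * b) h0) c
  rwa [smul_add, smul_smul, mul_inv_cancel_left₀ hc] at this

omit [Fintype K] in
theorem isVertex_smul (h : IsVertex F l w Q) (c : K) : IsVertex F l w (c • Q) := by
  intro u hu b h0
  rw [smul_smul]
  exact h u hu _ h0

theorem exists_isVertex (hF : IsExtremal F t) (hl : IsLineOn F l) (hQ : Q ∈ l) (hQ0 : Q ≠ 0) :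
    ∃ w, w ∉ l ∧ IsVertex F l w Q := by
  have : ¬ LinearMap.ker (polar F Q) ≤ l := by
    intro h
    have h1 := Submodule.finrank_mono h
    have h2 := LinearMap.finrank_range_add_finrank_ker (polar F Q)
    have h3 := Submodule.finrank_le (LinearMap.range (polar F Q))
    rw [hl.1] at h1
    simp at h2 h3
    omega
  obtain ⟨w, hw, hwl⟩ := SetLike.not_le_iff_exists.1 this
  exact ⟨w, hwl, fun u hu c h0 => eval_add_smul_eq_zero_of_polar hF.isHomogeneous hF.pos
    hF.lt_card hF.not_dvd hl.1 hl.2 hwl (hF.card_coset hl hwl) hQ hQ0 hw hu h0 c⟩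

theorem exists_bijective (hF : IsExtremal F t) (hl : IsLineOn F l) :
    ∃ φ : Projectivization K l → Projectivization K ((Fin 4 → K) ⧸ l), Function.Bijective φ ∧
      ∀ w (hw : l.mkQ w ≠ 0) (Q : l), (hQ : Q ≠ 0) →
        (φ (Projectivization.mk K Q hQ) = Projectivization.mk K (l.mkQ w) hw ↔
          IsVertex F l w Q) := by
  have hex : ∀ Q : Projectivization K l, ∃ w, w ∉ l ∧ IsVertex F l w Q.rep := fun Q =>
    hF.exists_isVertex hl Q.rep.2 (by simpa using Q.rep_nonzero)
  choose f hfl hf using hex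
  have hmk : ∀ w, l.mkQ w ≠ 0 ↔ w ∉ l := fun w => by simp
  have hmk2 : ∀ w w' hw hw', Projectivization.mk K (l.mkQ w) hw = Projectivization.mk K (l.mkQ w') hw' →
      ∀ Q, IsVertex F l w Q → IsVertex F l w' Q := by
    intro w w' hw hw' h Q hQ
    rw [Projectivization.mk_eq_mk_iff] at h
    obtain ⟨a, ha⟩ := h
    have h1 : w - a.1 • w' ∈ l := by
      rw [← Submodule.Quotient.eq]
      exact ha.symm
    have := hF.isVertex_smul_add (c := a.1⁻¹) (l.smul_mem (-a.1⁻¹) h1) (inv_ne_zero a.ne_zero) hQ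
    convert this using 1
    rw [smul_sub, smul_smul]
    simp
  let φ : Projectivization K l → Projectivization K ((Fin 4 → K) ⧸ l) := fun Q =>
    Projectivization.mk K (l.mkQ (f Q)) ((hmk _).2 (hfl Q))
  have hinj : Function.Injective φ := by
    intro Q R h
    by_contra hne
    have h1 := hmk2 _ _ _ _ h _ (hf Q)
    obtain ⟨c, hc⟩ := hF.eq_smul_of_isVertex_of_isVertex hl (hfl R) (hf R) R.rep.2
      (by simpa using R.rep_nonzero) Q.rep.2 h1
    exact Projectivization.rep_ne_smul_rep hne c (Subtype.ext hc)
  have hbij : Function.Bijective φ := by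
    have : Finite (Projectivization K ((Fin 4 → K) ⧸ l)) := inferInstance
    refine (Nat.bijective_iff_injective_and_card φ).2 ⟨hinj, ?_⟩
    rw [Projectivization.card_of_finrank_two _ _ hl.1, Projectivization.card_of_finrank_two]
    have := Submodule.finrank_quotient_add_finrank l
    rw [hl.1, Module.finrank_fin_fun] at this
    omega
  have hrep : ∀ Q : l, (hQ : Q ≠ 0) → ∃ a : K, a ≠ 0 ∧ a • Q = (Projectivization.mk K Q hQ).rep := by
    intro Q hQ
    obtain ⟨a, ha⟩ := Projectivization.exists_smul_eq_mk_rep K Q hQ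
    exact ⟨a, a.ne_zero, ha⟩
  refine ⟨φ, hbij, fun w hw Q hQ => ⟨fun h => ?_, fun h => ?_⟩⟩
  · have h1 := hmk2 _ _ _ _ h _ (hf _)
    obtain ⟨a, ha, h2⟩ := hrep Q hQ
    rw [← h2] at h1
    simpa [smul_smul, ha] using isVertex_smul h1 a⁻¹
  · obtain ⟨R, hR⟩ := hbij.2 (Projectivization.mk K (l.mkQ w) hw)
    have h1 := hmk2 _ _ _ _ hR _ (hf _)
    obtain ⟨c, hc⟩ := hF.eq_smul_of_isVertex_of_isVertex hl ((hmk w).1 hw) h1 R.rep.2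
      (by simpa using R.rep_nonzero) Q.2 h
    rw [← hR]
    congr 1
    rw [← R.mk_rep, Projectivization.mk_eq_mk_iff']
    exact ⟨c, Subtype.ext hc.symm⟩

theorem exists_vertex (hF : IsExtremal F t) (hl : IsLineOn F l) (hw : w ∉ l) :
    ∃ Q ∈ l, Q ≠ 0 ∧ IsVertex F l w Q := by
  obtain ⟨φ, hφ, h⟩ := hF.exists_bijective hl
  have hw' : l.mkQ w ≠ 0 := by simpa using hw
  obtain ⟨R, hR⟩ := hφ.2 (Projectivization.mk K (l.mkQ w) hw')
  refine ⟨R.rep, R.rep.2, by simpa using R.rep_nonzero, ?_⟩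
  rw [← h w hw' R.rep R.rep_nonzero, R.mk_rep, hR]

theorem exists_smul_add_mem (hF : IsExtremal F t) (hl : IsLineOn F l) (hw : w ∉ l) (hw' : w' ∉ l)
    (hQ : Q ∈ l) (hQ0 : Q ≠ 0) (h : IsVertex F l w Q) (h' : IsVertex F l w' Q) :
    ∃ c : K, ∃ u ∈ l, c • w' = u + w := by
  obtain ⟨φ, hφ, hv⟩ := hF.exists_bijective hl
  have h1 := (hv w (by simpa using hw) ⟨Q, hQ⟩ (by simpa using hQ0)).2 h
  have h2 := (hv w' (by simpa using hw') ⟨Q, hQ⟩ (by simpa using hQ0)).2 h'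
  have h3 := h1.symm.trans h2
  rw [Projectivization.mk_eq_mk_iff'] at h3
  obtain ⟨c, hc⟩ := h3
  refine ⟨c, c • w' - w, ?_, by abel⟩
  rw [← Submodule.Quotient.eq]
  exact hc

end IsExtremal

/-- Incidence between the points and the lines of the surface `F = 0`. -/
def Incident (F : MvPolynomial (Fin 4) K)
    (p : {p : Projectivization K (Fin 4 → K) // eval p.rep F = 0})
    (l : {l : Submodule K (Fin 4 → K) // IsLineOn F l}) : Prop :=
  p.1.rep ∈ l.1

namespace IsExtremal

variable [Fintype K] {t : ℕ} {F : MvPolynomial (Fin 4) K} {l m : Submodule K (Fin 4 → K)}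
  {P Q R u w w' : Fin 4 → K}

theorem exists_point (hF : IsExtremal F t) (hQ : eval Q F = 0) (hQ0 : Q ≠ 0) :
    ∃ p : {p : Projectivization K (Fin 4 → K) // eval p.rep F = 0}, ∃ a : K, a ≠ 0 ∧
      p.1.rep = a • Q := by
  obtain ⟨a, ha⟩ := Projectivization.exists_smul_eq_mk_rep K Q hQ0
  have ha : (Projectivization.mk K Q hQ0).rep = a.1 • Q := ha.symm
  exact ⟨⟨Projectivization.mk K Q hQ0, by rw [ha]; exact hF.smul hQ _⟩, a, a.ne_zero, ha⟩

theorem natCard_incident_points (l : {l : Submodule K (Fin 4 → K) // IsLineOn F l}) :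
    Nat.card {p // Incident F p l} = Fintype.card K + 1 := by
  classical
  have e : {p // Incident F p l} ≃ {p : Projectivization K (Fin 4 → K) // p.rep ∈ l.1} :=
    Equiv.subtypeSubtypeEquivSubtype fun {x} hx => l.2.2 _ hx
  have h := natCard_nonzero_eq_mul (K := K) (V := Fin 4 → K) (p := fun v => v ∈ l.1)
    fun v c _ h => l.1.smul_mem c h
  have h1 : Nat.card {v : Fin 4 → K // v ≠ 0 ∧ v ∈ l.1} + 1 = Fintype.card K ^ 2 := by
    have h2 : Fintype.card K ^ 2 = (Finset.univ.filter fun v => v ∈ l.1).card := by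
      rw [← l.2.1, ← Module.card_eq_pow_finrank (K := K) (V := l.1), ← Fintype.card_subtype]
    have h3 : (Finset.univ.filter fun v => v ≠ 0 ∧ v ∈ l.1) =
        (Finset.univ.filter fun v => v ∈ l.1).erase 0 := by
      ext; simp
    rw [Nat.card_eq_fintype_card, Fintype.card_subtype, h2, h3, Finset.card_erase_add_one]
    simp
  rw [Nat.card_congr e]
  rw [h] at h1
  have hq : 1 < Fintype.card K := Fintype.one_lt_card
  apply Nat.eq_of_mul_eq_mul_right (show 0 < Fintype.card K - 1 by omega)
  obtain ⟨r, hr⟩ := Nat.exists_eq_add_of_le hq.le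
  rw [hr] at h1 ⊢
  rw [Nat.add_sub_cancel_left] at h1 ⊢
  linarith

omit [Fintype K] in
theorem notMem_of_ne (hl : IsLineOn F l) (hm : IsLineOn F m) (hne : l ≠ m) (hQl : Q ∈ l)
    (hQm : Q ∈ m) (hQ0 : Q ≠ 0) (hP : P ∈ m) (hPQ : ∀ c : K, P ≠ c • Q) : P ∉ l := fun hPl =>
  hne (eq_of_mem_of_mem hl.1 hm.1 hPl hQl hP hQm hQ0 hPQ)

theorem exists_add_mem (hF : IsExtremal F t) (hl : IsLineOn F l) (hm : IsLineOn F m) (hne : l ≠ m)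
    (hQl : Q ∈ l) (hQm : Q ∈ m) (hQ0 : Q ≠ 0) (hw : w ∉ l) (hv : IsVertex F l w Q) :
    ∃ u ∈ l, u + w ∈ m := by
  obtain ⟨w', hw'm, hw'⟩ := exists_mem_forall_ne_smul hm.1 hQm hQ0
  have hw'l := notMem_of_ne hl hm hne hQl hQm hQ0 hw'm hw'
  obtain ⟨R, hR, hR0, hvR⟩ := hF.exists_vertex hl hw'l
  obtain ⟨c, rfl⟩ := hF.eq_smul_of_isVertex hl hw'l hvR hR hR0 hQl l.zero_mem fun c => by
    rw [zero_add]
    exact hm.2 _ (m.add_mem hw'm (m.smul_mem _ hQm))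
  obtain ⟨a, u, hu, h⟩ := hF.exists_smul_add_mem hl hw hw'l hQl hQ0 hv (isVertex_smul hvR c)
  exact ⟨u, hu, h ▸ m.smul_mem _ hw'm⟩

theorem natCard_incident_lines (hF : IsExtremal F t)
    (p : {p : Projectivization K (Fin 4 → K) // eval p.rep F = 0}) :
    Nat.card {l // Incident F p l} = t + 1 := by
  classical
  obtain ⟨p, hp⟩ := p
  set Q := p.rep with hQ
  have hQ0 : Q ≠ 0 := p.rep_nonzero
  obtain ⟨l, hl, hQl⟩ := hF.exists_line hp hQ0
  obtain ⟨w, hw, hv⟩ := hF.exists_isVertex hl hQl hQ0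
  have hne : ∀ u ∈ l, ∀ c : K, u + w ≠ c • Q := fun u hu c h => hw <| by
    have := l.sub_mem (l.smul_mem c hQl) hu
    rwa [← h, add_sub_cancel_left] at this
  have : Fintype {l : Submodule K (Fin 4 → K) // IsLineOn F l} := Fintype.ofFinite _
  let T := Finset.univ.filter fun m : {l // IsLineOn F l} => Q ∈ m.1 ∧ m.1 ≠ l
  let Z := Finset.univ.filter fun u : l => eval (u.1 + w) F = 0
  have hZ : Z.card = t * Fintype.card K := by
    rw [← hF.card_coset hl hw, Nat.card_eq_fintype_card, Fintype.card_subtype]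
  have h1 : ∀ u ∈ Z, (T.bipartiteAbove (fun (u : l) m => u.1 + w ∈ m.1) u).card = 1 := by
    intro u hu
    have hu : eval (u.1 + w) F = 0 := by simpa [Z] using hu
    have hm := hF.isLineOn_span hQ0 hp (hne _ u.2) fun c => hv u u.2 c hu
    have hmem1 : u.1 + w ∈ Submodule.span K {u.1 + w, Q} := Submodule.subset_span (by simp)
    have hmem2 : Q ∈ Submodule.span K {u.1 + w, Q} := Submodule.subset_span (by simp)
    rw [Finset.card_eq_one]
    refine ⟨⟨_, hm⟩, ?_⟩
    ext m
    simp only [Finset.mem_bipartiteAbove, T, Finset.mem_filter, Finset.mem_univ, true_and,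
      Finset.mem_singleton]
    constructor
    · rintro ⟨⟨hQm, -⟩, hum⟩
      exact Subtype.ext (eq_of_mem_of_mem m.2.1 hm.1 hum hQm hmem1 hmem2 hQ0 (hne _ u.2))
    · rintro rfl
      refine ⟨⟨hmem2, fun h => hw ?_⟩, hmem1⟩
      change Submodule.span K {u.1 + w, Q} = l at h
      rw [h] at hmem1
      exact (l.add_mem_iff_right u.2).1 hmem1
  have h2 : ∀ m ∈ T, (Z.bipartiteBelow (fun (u : l) m => u.1 + w ∈ m.1) m).card =
      Fintype.card K := by
    intro m hm
    simp only [T, Finset.mem_filter, Finset.mem_univ, true_and] at hm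
    obtain ⟨u₀, hu₀, hmem⟩ := hF.exists_add_mem hl m.2 hm.2.symm hQl hm.1 hQ0 hw hv
    let g : K → l := fun c => ⟨u₀ + c • Q, l.add_mem hu₀ (l.smul_mem c hQl)⟩
    have hg : Function.Injective g := fun a b h => by
      have : u₀ + a • Q = u₀ + b • Q := congrArg Subtype.val h
      exact smul_left_injective K hQ0 (add_left_cancel this)
    rw [← Finset.card_univ, ← Finset.card_image_of_injective _ hg]
    congr 1
    ext u
    simp only [Finset.mem_bipartiteBelow, Z, Finset.mem_filter, Finset.mem_univ, true_and,
      Finset.mem_image]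
    constructor
    · rintro ⟨-, hu⟩
      by_contra! h
      have hsub : u.1 - u₀ ∈ m.1 := by
        have := m.1.sub_mem hu hmem
        rwa [add_sub_add_right_eq_sub] at this
      refine notMem_of_ne hl m.2 hm.2.symm hQl hm.1 hQ0 hsub (fun c hc => ?_)
        (l.sub_mem u.2 hu₀)
      refine h c (Subtype.ext ?_)
      change u₀ + c • Q = u.1
      rw [← hc]
      abel
    · rintro ⟨c, rfl⟩
      have : u₀ + c • Q + w ∈ m.1 := by
        rw [add_right_comm]
        exact m.1.add_mem hmem (m.1.smul_mem c hm.1)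
      exact ⟨m.2.2 _ this, this⟩
  have h3 := Finset.card_mul_eq_card_mul (s := Z) (t := T) (fun (u : l) m => u.1 + w ∈ m.1) h1 h2
  rw [hZ, mul_one] at h3
  have hT : t = T.card := Nat.eq_of_mul_eq_mul_right Fintype.card_pos h3
  have h4 : T = (Finset.univ.filter fun m => Incident F ⟨p, hp⟩ m).erase ⟨l, hl⟩ := by
    ext m
    simp only [T, Finset.mem_filter, Finset.mem_univ, true_and, Finset.mem_erase,
      ne_eq, Subtype.ext_iff]
    exact and_comm
  rw [Nat.card_eq_fintype_card, Fintype.card_subtype, hT, h4, Finset.card_erase_add_one]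
  exact Finset.mem_filter.2 ⟨Finset.mem_univ _, hQl⟩

theorem isGeneralizedQuadrangle (hF : IsExtremal F t) :
    IsGeneralizedQuadrangle (Incident F) (Fintype.card K) t where
  natCard_points := natCard_incident_points
  natCard_lines := hF.natCard_incident_lines
  line_unique {p r l m} hpr hpl hrl hpm hrm :=
    Subtype.ext (eq_of_mem_of_mem l.2.1 m.2.1 hpl hrl hpm hrm r.1.rep_nonzero
      (Projectivization.rep_ne_smul_rep fun h => hpr (Subtype.ext h)))
  exists_transversal {p l} hpl := by
    obtain ⟨Q, hQ, hQ0, hv⟩ := hF.exists_vertex l.2 hpl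
    have hpQ : ∀ c : K, p.1.rep ≠ c • Q := fun c hc => by
      have := l.1.smul_mem c hQ
      exact hpl (by rwa [← hc] at this)
    have hm := hF.isLineOn_span hQ0 (l.2.2 _ hQ) hpQ fun c => by
      have := hv 0 l.1.zero_mem c (by simpa using p.2)
      simpa using this
    obtain ⟨r, a, -, hr⟩ := hF.exists_point (l.2.2 _ hQ) hQ0
    refine ⟨⟨_, hm⟩, Submodule.subset_span (by simp), r, ?_, ?_⟩
    · rw [Incident, hr]
      exact Submodule.smul_mem _ _ (Submodule.subset_span (by simp))
    · rw [Incident, hr]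
      exact l.1.smul_mem _ hQ
  transversal_unique {p l m n} hpl hpm hm hpn hn := by
    obtain ⟨r, hrm, hrl⟩ := hm
    obtain ⟨x, hxn, hxl⟩ := hn
    obtain ⟨Q, hQ, hQ0, hv⟩ := hF.exists_vertex l.2 hpl
    have key : ∀ (y : {p : Projectivization K (Fin 4 → K) // eval p.rep F = 0})
        (k : {l : Submodule K (Fin 4 → K) // IsLineOn F l}), Incident F p k → Incident F y k →
        Incident F y l → y.1 = Projectivization.mk K Q hQ0 := by
      intro y k hpk hyk hyl
      obtain ⟨c, hc⟩ := hF.eq_smul_of_isVertex l.2 hpl hv hQ hQ0 hyl l.1.zero_mem fun c => by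
        rw [zero_add]
        exact k.2.2 _ (k.1.add_mem hpk (k.1.smul_mem c hyk))
      rw [← y.1.mk_rep, Projectivization.mk_eq_mk_iff']
      exact ⟨c, hc.symm⟩
    have hrx : r = x := Subtype.ext ((key r m hpm hrm hrl).trans (key x n hpn hxn hxl).symm)
    subst hrx
    have hpr : p.1 ≠ r.1 := fun h => hpl (by
      have : p = r := Subtype.ext h
      rw [this]
      exact hrl)
    exact Subtype.ext (eq_of_mem_of_mem m.2.1 n.2.1 hpm hrm hpn hxn r.1.rep_nonzero
      (Projectivization.rep_ne_smul_rep hpr))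

theorem card_le_sq (hF : IsExtremal F t) (ht : 1 < t) : Fintype.card K ≤ t ^ 2 := by
  have := Fintype.ofFinite {p : Projectivization K (Fin 4 → K) // eval p.rep F = 0}
  have := Fintype.ofFinite {l : Submodule K (Fin 4 → K) // IsLineOn F l}
  refine hF.isGeneralizedQuadrangle.le_sq ?_ Fintype.one_lt_card ht
  rw [← Nat.card_eq_fintype_card, hF.natCard_points, mul_comm t]

/-- On the line through `v` and `Q`, the vector `v` is the only zero of `F`. -/
def IsIsolated (F : MvPolynomial (Fin 4) K) (Q v : Fin 4 → K) : Prop :=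
  eval v F = 0 ∧ ∀ c : K, c ≠ 0 → eval (v + c • Q) F ≠ 0

theorem isIsolated_smul (hF : IsExtremal F t) {v : Fin 4 → K} {c : K} (hc : c ≠ 0)
    (h : IsIsolated F Q v) : IsIsolated F Q (c • v) := by
  refine ⟨hF.smul h.1 c, fun b hb h0 => h.2 (c⁻¹ * b) (mul_ne_zero (inv_ne_zero hc) hb) ?_⟩
  have := hF.smul h0 c⁻¹
  rwa [smul_add, smul_smul, smul_smul, inv_mul_cancel₀ hc, one_smul] at this

theorem exists_eval_ne_zero (hF : IsExtremal F t) : ∃ Q, eval Q F ≠ 0 := by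
  by_contra! h
  refine hF.not_dvd ⟨Pi.single 0 1, by simp, ?_⟩
  exact linForm_dvd_of_forall_eval_eq_zero hF.isHomogeneous hF.lt_card (by simp) fun v _ => h v

theorem exists_isIsolated (hF : IsExtremal F t) (hQ : eval Q F ≠ 0) (hl : IsLineOn F l) :
    ∃ v ∈ l, v ≠ 0 ∧ IsIsolated F Q v := by
  obtain ⟨v, hv, hv0, h⟩ := hF.exists_vertex (w := Q) hl fun h => hQ (hl.2 _ h)
  refine ⟨v, hv, hv0, hl.2 _ hv, fun c hc h0 => hQ ?_⟩
  have h1 := hF.smul h0 c⁻¹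
  rw [smul_add, inv_smul_smul₀ hc] at h1
  have h2 := h _ (l.smul_mem c⁻¹ hv) (-c⁻¹) h1
  have h3 : c⁻¹ • v + Q + -c⁻¹ • v = Q := by module
  rwa [h3] at h2

theorem natCard_isIsolated_ge (hF : IsExtremal F t) (hQ : eval Q F ≠ 0) :
    t * Fintype.card K + 1 ≤
      Nat.card {p : Projectivization K (Fin 4 → K) // IsIsolated F Q p.rep} := by
  classical
  have := Fintype.ofFinite {p : Projectivization K (Fin 4 → K) // eval p.rep F = 0}
  have := Fintype.ofFinite {l : Submodule K (Fin 4 → K) // IsLineOn F l}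
  have hGQ := hF.isGeneralizedQuadrangle
  have hL := hGQ.card_lines_mul
  rw [← Nat.card_eq_fintype_card (α := {p : Projectivization K (Fin 4 → K) // eval p.rep F = 0}),
    hF.natCard_points] at hL
  let O := Finset.univ.filter fun p : {p : Projectivization K (Fin 4 → K) // eval p.rep F = 0} =>
    IsIsolated F Q p.1.rep
  have hO : Nat.card {p : Projectivization K (Fin 4 → K) // IsIsolated F Q p.rep} = O.card := by
    rw [← Fintype.card_subtype, ← Nat.card_eq_fintype_card]
    exact (Nat.card_congr (Equiv.subtypeSubtypeEquivSubtype fun {x} hx => hx.1)).symm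
  have h := Finset.card_mul_le_card_mul (s := Finset.univ) (t := O) (m := 1) (n := t + 1)
    (fun l p => Incident F p l) (fun l _ => ?_) (fun p _ => ?_)
  · rw [hO]
    rw [mul_one, Finset.card_univ] at h
    have h1 := Nat.mul_le_mul_right (Fintype.card K + 1) h
    rw [hL] at h1
    have h2 : (t * Fintype.card K + 1) * ((t + 1) * (Fintype.card K + 1)) ≤
      O.card * ((t + 1) * (Fintype.card K + 1)) := by linarith
    exact Nat.le_of_mul_le_mul_right h2 (by positivity)
  · obtain ⟨v, hv, hv0, hi⟩ := hF.exists_isIsolated hQ l.2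
    obtain ⟨p, a, ha, hp⟩ := hF.exists_point hi.1 hv0
    rw [Nat.one_le_iff_ne_zero, Finset.card_ne_zero]
    refine ⟨p, ?_⟩
    simp only [Finset.mem_bipartiteAbove, O, Finset.mem_filter, Finset.mem_univ, true_and]
    rw [Incident, hp]
    exact ⟨hF.isIsolated_smul ha hi, l.1.smul_mem a hv⟩
  · rw [← hGQ.natCard_lines p, Nat.card_eq_fintype_card, Fintype.card_subtype]
    rfl

theorem sum_add_smul_le (hF : IsExtremal F t) (hQ : eval Q F ≠ 0) (w : Fin 4 → K)
    [DecidablePred (IsIsolated F Q)] [DecidablePred fun v : Fin 4 → K => eval v F = 0] :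
    ∑ c : K, ((if eval (w + c • Q) F = 0 then 1 else 0) +
      if IsIsolated F Q (w + c • Q) then t else 0) ≤ t + 1 := by
  by_cases h : ∃ a : K, IsIsolated F Q (w + a • Q)
  · obtain ⟨a, ha⟩ := h
    rw [Finset.sum_eq_single a]
    · rw [if_pos ha, if_pos ha.1, add_comm]
    · intro c _ hca
      have h1 := ha.2 (c - a) (sub_ne_zero.2 hca)
      have h2 : w + a • Q + (c - a) • Q = w + c • Q := by module
      rw [h2] at h1
      rw [if_neg h1, if_neg fun hi => h1 hi.1, add_zero]
    · simp
  · push Not at h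
    have := (card_add_smul_le hF.isHomogeneous (w := w) (Or.inr hQ)).1
    rw [Nat.card_eq_fintype_card, Fintype.card_subtype] at this
    simpa [h] using this

theorem sq_le_card (hF : IsExtremal F t) : t ^ 2 ≤ Fintype.card K := by
  classical
  obtain ⟨Q, hQ⟩ := hF.exists_eval_ne_zero
  have hQ0 : Q ≠ 0 := fun h => hQ (h ▸ hF.eval_zero)
  set W := K ∙ Q with hW
  have hO := natCard_nonzero_eq_mul (K := K) (V := Fin 4 → K) (p := IsIsolated F Q)
    fun v c hc h => hF.isIsolated_smul hc h
  rw [Nat.card_eq_fintype_card, Fintype.card_subtype] at hO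
  have hge := hF.natCard_isIsolated_ge hQ
  have hcard := hF.card_nonzero
  have hWv : ∀ v, eval v F = 0 → (v ∉ W ↔ v ≠ 0) := by
    refine fun v hv => not_congr ⟨fun h => ?_, fun h => h ▸ W.zero_mem⟩
    obtain ⟨c, rfl⟩ := Submodule.mem_span_singleton.1 h
    by_contra hc
    rw [smul_eq_zero, not_or] at hc
    exact hQ ((eval_smul_eq_zero_iff hF.isHomogeneous hc.1).1 hv)
  have hsum := sum_sum_add W (fun c : K => c • Q)
    (fun c => Submodule.smul_mem _ _ (Submodule.mem_span_singleton_self Q))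
    (fun v => (if eval v F = 0 then 1 else 0) + if IsIsolated F Q v then t else 0)
  have hle := Finset.sum_le_sum fun w (_ : w ∈ Finset.univ.filter (· ∉ W)) =>
    hF.sum_add_smul_le hQ w
  rw [hsum, Finset.sum_add_distrib, ← Finset.sum_filter, ← Finset.sum_filter, Finset.sum_const,
    Finset.sum_const, Finset.filter_filter, Finset.filter_filter, Finset.sum_const, card_notMem,
    finrank_span_singleton hQ0] at hle
  have h1 : (Finset.univ.filter fun v => v ∉ W ∧ eval v F = 0) =
      Finset.univ.filter fun v => v ≠ 0 ∧ eval v F = 0 :=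
    Finset.filter_congr fun v _ => and_congr_left fun h => hWv v h
  have h2 : (Finset.univ.filter fun v => v ∉ W ∧ IsIsolated F Q v) =
      Finset.univ.filter fun v => v ≠ 0 ∧ IsIsolated F Q v :=
    Finset.filter_congr fun v _ => and_congr_left fun h => hWv v h.1
  rw [h1, h2, hcard, hO] at hle
  set n := Nat.card {p : Projectivization K (Fin 4 → K) // IsIsolated F Q p.rep}
  have hq : 1 < Fintype.card K := Fintype.one_lt_card
  obtain ⟨r, hr⟩ : ∃ r, Fintype.card K = r + 1 := ⟨Fintype.card K - 1, by omega⟩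
  have hr0 : 0 < r := by omega
  rw [hr] at hle hge ⊢
  have h4 : (r + 1) ^ 4 - (r + 1) ^ 1 = ((r + 1) * r) * ((r + 1) ^ 2 + (r + 1) + 1) := by
    rw [Nat.sub_eq_iff_eq_add (Nat.pow_le_pow_right (by omega) (by omega))]
    ring
  rw [h4, Nat.add_sub_cancel] at hle
  simp only [smul_eq_mul, mul_one] at hle
  have h5 : ((r + 1) * r) * ((r + 2) * (t * (r + 1) + 1) + t * n) ≤
      ((r + 1) * r) * ((t + 1) * ((r + 1) ^ 2 + (r + 1) + 1)) := by linarith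
  have h6 := Nat.le_of_mul_le_mul_left h5 (by positivity)
  have h7 := Nat.mul_le_mul_left t hge
  have h8 : (r + 1) * t ^ 2 ≤ (r + 1) * (r + 1) := by linarith
  exact Nat.le_of_mul_le_mul_left h8 (by omega)

end IsExtremal

/-- If a surface of degree `d` in `P^3` over `F_q` without `F_q`-plane
components, with `2 ≤ d ≤ q+1`, attains the elementary bound `N_q(S) = (d-1)q² + dq + 1`,
then `d = 2`, or `q` is a square and `d = √q + 1`, or `d = q + 1`. -/
theorem possible_degrees (K : Type) [Field K] [Fintype K]
    (d : ℕ) (F : MvPolynomial (Fin 4) K)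
    (hhom : F.IsHomogeneous d) (hsf : Squarefree F)
    (hnoplane : ¬ ∃ a : Fin 4 → K, a ≠ 0 ∧ linForm a ∣ F)
    (hd2 : 2 ≤ d) (hdq : d ≤ Fintype.card K + 1)
    (hN : Nat.card {p : Projectivization K (Fin 4 → K) // MvPolynomial.eval p.rep F = 0} =
      (d - 1) * Fintype.card K ^ 2 + d * Fintype.card K + 1) :
    d = 2 ∨ (∃ m : ℕ, Fintype.card K = m ^ 2 ∧ d = m + 1) ∨ d = Fintype.card K + 1 := by
  obtain ⟨t, rfl⟩ : ∃ t, d = t + 1 := ⟨d - 1, by omega⟩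
  by_cases hq : t + 1 ≤ Fintype.card K
  · have hF : IsExtremal F t := ⟨hhom, by omega, hq, hnoplane, by
      rw [hN, Nat.add_sub_cancel]
      ring⟩
    by_cases ht : 1 < t
    · exact Or.inr (Or.inl ⟨t, le_antisymm (hF.card_le_sq ht) hF.sq_le_card, rfl⟩)
    · exact Or.inl (by omega)
  · exact Or.inr (Or.inr (by omega))
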